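/- For every nontrivial element w ∈ TS', the stabilizer in Out(F_k) = Aut(F_k)/Inn(F_k) of the conjugacy class of w is trivial; that is, if α ∈ Aut(F_k) satisfies that α(w) is conjugate to w, then the image of α in Out(F_k) is trivial. -/

import Mathlib

/-! Common definitions: free group `FG k = F(a_1,…,a_k)`, reduced and cyclically
reduced words, Whitehead automorphisms, strict minimality, counting functions and
exponential genericity, following Kapovich–Schupp–Shpilrain. -/

/-- The free group of rank `k` on the basis `a_1,…,a_k`. -/
abbrev FG (k : ℕ) := FreeGroup (Fin k)

/-- The alphabet `Σ = {a_1,…,a_k}^{±1}`: a letter is a basis index together with a sign. -/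
abbrev Letter (k : ℕ) := Fin k × Bool

/-- The inverse of a letter. -/
def linv {k : ℕ} (x : Letter k) : Letter k := (x.1, !x.2)

/-- The length `|g|` of the reduced word representing `g`. -/
def wordLength {k : ℕ} (g : FG k) : ℕ := (FreeGroup.toWord g).length

/-- A word is (freely) reduced if it equals its free reduction. -/
def ReducedWord {k : ℕ} (w : List (Letter k)) : Prop := FreeGroup.reduce w = w

/-- A word is cyclically reduced if all of its cyclic permutations are reduced;
equivalently, `w ++ w` is reduced. -/
def CyclicallyReducedWord {k : ℕ} (w : List (Letter k)) : Prop :=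
  FreeGroup.reduce (w ++ w) = w ++ w

/-- An element of `FG k` is cyclically reduced if its reduced word is. -/
def IsCyclicallyReduced {k : ℕ} (g : FG k) : Prop :=
  CyclicallyReducedWord (FreeGroup.toWord g)

/-- `C`, the set of all cyclically reduced elements of `FG k`. -/
def Cset (k : ℕ) : Set (FG k) := {g | IsCyclicallyReduced g}

/-- The cyclic length `‖g‖`: the length of the cyclically reduced form of `g`
(the unique cyclically reduced `u` with `g = x u x⁻¹`). -/
noncomputable def cyclicLength {k : ℕ} (g : FG k) : ℕ :=
  sInf {n | ∃ x u : FG k, IsCyclicallyReduced u ∧ g = x * u * x⁻¹ ∧ wordLength u = n}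

/-- The set `Σ = {a_1,…,a_k}^{±1}` inside the free group. -/
def letterSet (k : ℕ) : Set (FG k) :=
  {g | ∃ i : Fin k, g = FreeGroup.of i ∨ g = (FreeGroup.of i)⁻¹}

/-- A Whitehead automorphism of the first kind: a relabeling automorphism,
i.e. one whose restriction to `Σ` is a permutation of `Σ`. -/
def IsRelabeling {k : ℕ} (τ : MulAut (FG k)) : Prop :=
  (⇑τ) '' letterSet k = letterSet k

/-- A Whitehead automorphism of the second kind, with multiplier `a ∈ Σ`:
`τ a = a` and `τ x ∈ {x, xa, a⁻¹x, a⁻¹xa}` for all `x ∈ Σ`. -/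
def IsWhitehead2 {k : ℕ} (τ : MulAut (FG k)) : Prop :=
  ∃ a ∈ letterSet k, τ a = a ∧
    ∀ x ∈ letterSet k, τ x = x ∨ τ x = x * a ∨ τ x = a⁻¹ * x ∨ τ x = a⁻¹ * x * a

/-- An automorphism is inner if it is conjugation by some element. -/
def IsInner {k : ℕ} (α : MulAut (FG k)) : Prop := ∃ g : FG k, α = MulAut.conj g

/-- `SM`: the set of strictly minimal cyclically reduced elements, those `w` with
`‖τ w‖ > |w|` for every non-inner Whitehead automorphism `τ` of the second kind. -/
def SM (k : ℕ) : Set (FG k) :=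
  {w | IsCyclicallyReduced w ∧
    ∀ τ : MulAut (FG k), IsWhitehead2 τ → ¬ IsInner τ → wordLength w < cyclicLength (τ w)}

/-- `SM'`: elements whose cyclically reduced form lies in `SM`. -/
def SM' (k : ℕ) : Set (FG k) := {g | ∃ x u : FG k, u ∈ SM k ∧ g = x * u * x⁻¹}

/-- `γ(n,S)`: the number of elements of `S` of length `n`. -/
noncomputable def gammaC {k : ℕ} (S : Set (FG k)) (n : ℕ) : ℕ :=
  {g ∈ S | wordLength g = n}.ncard

/-- `ρ(n,S)`: the number of elements of `S` of length at most `n`. -/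
noncomputable def rhoC {k : ℕ} (S : Set (FG k)) (n : ℕ) : ℕ :=
  {g ∈ S | wordLength g ≤ n}.ncard

/-- `B ⊆ S` is exponentially generic in `S` if `ρ(n,B)/ρ(n,S) → 1`
exponentially fast. -/
def ExpGenericIn {k : ℕ} (B S : Set (FG k)) : Prop :=
  B ⊆ S ∧ ∃ K : ℝ, 0 < K ∧ ∃ σ : ℝ, 0 < σ ∧ σ < 1 ∧
    ∀ n : ℕ, |1 - (rhoC B n : ℝ) / (rhoC S n : ℝ)| ≤ K * σ ^ n

/-- `B` is exponentially negligible in `S` if `S \ B` is exponentially generic in `S`. -/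
def ExpNegligibleIn {k : ℕ} (B S : Set (FG k)) : Prop := ExpGenericIn (S \ B) S

/-- The orbit `Aut(F_k) w`. -/
def autOrbit {k : ℕ} (w : FG k) : Set (FG k) := {g | ∃ α : MulAut (FG k), α w = g}

/-- `u` is a cyclic permutation of `v`: the reduced word of `u` is a rotation of
the reduced word of `v`. -/
def IsCyclicPerm {k : ℕ} (u v : FG k) : Prop :=
  ∃ n : ℕ, FreeGroup.toWord u = (FreeGroup.toWord v).rotate n

/-- `w` is a proper power: `w = uⁿ` for some `n ≥ 2`. -/
def IsProperPower {k : ℕ} (w : FG k) : Prop := ∃ (u : FG k) (n : ℕ), 2 ≤ n ∧ w = u ^ n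

/-- `TS`: strictly minimal cyclically reduced `w` which are not proper powers and
are not conjugate to `τ w` for any nontrivial relabeling automorphism `τ`. -/
def TS (k : ℕ) : Set (FG k) :=
  {w | w ∈ SM k ∧ ¬ IsProperPower w ∧
    ∀ τ : MulAut (FG k), IsRelabeling τ → τ ≠ 1 → ¬ IsConj (τ w) w}

/-- `TS'`: elements whose cyclically reduced form lies in `TS`. -/
def TS' (k : ℕ) : Set (FG k) := {g | ∃ x u : FG k, u ∈ TS k ∧ g = x * u * x⁻¹}

/-- `Z`: elements of `TS` such that no relabeling automorphism sends `w` to a cyclic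
permutation of `w⁻¹`. -/
def Zset (k : ℕ) : Set (FG k) :=
  {w | w ∈ TS k ∧ ¬ ∃ τ : MulAut (FG k), IsRelabeling τ ∧ IsCyclicPerm (τ w) w⁻¹}

/-- Growth entropy `H(S) = limsup ρ(n,S)^{1/n}`. -/
noncomputable def entropyH {k : ℕ} (S : Set (FG k)) : ℝ :=
  Filter.limsup (fun n : ℕ => (rhoC S n : ℝ) ^ ((n : ℝ)⁻¹)) Filter.atTop

/-- Number of occurrences of the two-letter word `xy` as a subword of `w`. -/
def countPair {k : ℕ} (w : List (Letter k)) (x y : Letter k) : ℕ :=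
  (w.zip w.tail).count (x, y)

/-- The label `ŵ_{xy}` of the edge `[x⁻¹, y]` in the weighted Whitehead graph of the
cyclically reduced word `w`: occurrences of `xy` and of `y⁻¹x⁻¹` in `wc`, where `c` is
the first letter of `w`. -/
def whLabel {k : ℕ} (w : List (Letter k)) (x y : Letter k) : ℕ :=
  countPair (w ++ w.take 1) x y + countPair (w ++ w.take 1) (linv y) (linv x)

/-- The one-relator group `G_u = ⟨a_1,…,a_k ∣ u = 1⟩`. -/
abbrev OneRel (k : ℕ) (u : FG k) := FG k ⧸ Subgroup.normalClosure ({u} : Set (FG k))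

/-- `u` is primitive: it belongs to some free basis of `FG k`, equivalently it is the
image of a basis element under an automorphism. -/
def IsPrimitive {k : ℕ} (u : FG k) : Prop :=
  ∃ (α : MulAut (FG k)) (i : Fin k), α (FreeGroup.of i) = u

section Proof
open FreeGroup

/-- The group element of a letter. -/
def EL {k : ℕ} (x : Letter k) : FG k := FreeGroup.mk [x]

/-- The first letter. -/
def hd {k : ℕ} (q : FG k) : Option (Letter k) := (FreeGroup.toWord q).head?

theorem linv_linv {k : ℕ} (x : Letter k) : linv (linv x) = x := by simp [linv]

theorem linv_ne {k : ℕ} (x : Letter k) : linv x ≠ x := by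
  intro h; have := congrArg Prod.snd h; simp [linv] at this

theorem rel_iff {k : ℕ} (x y : Letter k) : (x.1 = y.1 → x.2 = y.2) ↔ y ≠ linv x := by
  obtain ⟨i, b⟩ := x
  obtain ⟨j, c⟩ := y
  simp only [linv, ne_eq, Prod.mk.injEq, not_and]
  constructor
  · rintro h rfl; have := h rfl; subst this; simp
  · rintro h rfl; have := h rfl; revert this; cases b <;> cases c <;> simp

theorem EL_inv {k : ℕ} (x : Letter k) : (EL x)⁻¹ = EL (linv x) := by
  simp [EL, linv, FreeGroup.inv_mk, FreeGroup.invRev]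

theorem toWord_mk_red {k : ℕ} {l : List (Letter k)} (h : FreeGroup.IsReduced l) :
    toWord (FreeGroup.mk l) = l := by
  rw [toWord_mk, h.reduce_eq]

theorem norm_mk_red {k : ℕ} {l : List (Letter k)} (h : FreeGroup.IsReduced l) :
    FreeGroup.norm (FreeGroup.mk l) = l.length := by
  rw [FreeGroup.norm, toWord_mk_red h]

theorem toWord_EL {k : ℕ} (x : Letter k) : toWord (EL x) = [x] := rfl

theorem norm_EL {k : ℕ} (x : Letter k) : FreeGroup.norm (EL x) = 1 := rfl

theorem hd_one {k : ℕ} : hd (1 : FG k) = none := rfl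

theorem hd_EL {k : ℕ} (x : Letter k) : hd (EL x) = some x := rfl

theorem hd_none {k : ℕ} {q : FG k} : hd q = none ↔ q = 1 := by
  simp [hd]

theorem mk_append_EL {k : ℕ} (l : List (Letter k)) (x : Letter k) :
    FreeGroup.mk l * EL x = FreeGroup.mk (l ++ [x]) := by
  simp [EL, FreeGroup.mul_mk]

theorem mk_cons {k : ℕ} (l : List (Letter k)) (x : Letter k) :
    FreeGroup.mk (x :: l) = EL x * FreeGroup.mk l := by
  simp [EL, FreeGroup.mul_mk]

theorem red_append {k : ℕ} {l m : List (Letter k)} (hl : FreeGroup.IsReduced l) (hm : FreeGroup.IsReduced m)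
    (h : ∀ x ∈ l.getLast?, ∀ y ∈ m.head?, y ≠ linv x) : FreeGroup.IsReduced (l ++ m) := by
  rw [FreeGroup.IsReduced, List.isChain_append]
  refine ⟨hl, hm, fun x hx y hy => (rel_iff x y).2 (h x hx y hy)⟩

theorem red_append_iff {k : ℕ} {l m : List (Letter k)} : FreeGroup.IsReduced (l ++ m) ↔
    FreeGroup.IsReduced l ∧ FreeGroup.IsReduced m ∧ (∀ x ∈ l.getLast?, ∀ y ∈ m.head?, y ≠ linv x) := by
  rw [FreeGroup.IsReduced, List.isChain_append]
  refine and_congr Iff.rfl (and_congr Iff.rfl ?_)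
  refine forall_congr' fun x => forall_congr' fun _ => forall_congr' fun y =>
    forall_congr' fun _ => rel_iff x y

theorem hd_step {k : ℕ} (q : FG k) (x : Letter k) (h : hd (q * EL x) ≠ hd q) :
    q = 1 ∨ q * EL x = 1 := by
  by_contra hc
  push Not at hc
  obtain ⟨h1, h2⟩ := hc
  apply h
  rcases List.eq_nil_or_concat' (toWord q) with he | ⟨L, y, he⟩
  · exact absurd (toWord_eq_nil_iff.1 he) h1
  have hq : q = FreeGroup.mk (L ++ [y]) := by rw [← he, mk_toWord]
  have hr : FreeGroup.IsReduced (L ++ [y]) := by rw [← he]; exact isReduced_toWord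
  by_cases hy : x = linv y
  · have : q * EL x = FreeGroup.mk L := by
      rw [hq, ← mk_append_EL, hy, ← EL_inv, mul_assoc, mul_inv_cancel, mul_one]
    have hL : FreeGroup.IsReduced L := (red_append_iff.1 hr).1
    have hne : L ≠ [] := by
      rintro rfl; apply h2; rw [this]; rfl
    rw [this, hd, hd, toWord_mk_red hL, he, List.head?_append_of_ne_nil _ hne]
  · have hr2 : FreeGroup.IsReduced (L ++ [y] ++ [x]) := by
      apply red_append hr FreeGroup.IsReduced.singleton
      simpa using hy
    rw [hd, hd, he, hq, mk_append_EL, toWord_mk_red hr2, List.head?_append_of_ne_nil _ (by simp)]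

theorem hd_path {k : ℕ} (l : List (Letter k)) : ∀ (q : FG k),
    (∀ j ≤ l.length, q * FreeGroup.mk (l.take j) ≠ 1) → hd (q * FreeGroup.mk l) = hd q := by
  induction l with
  | nil => intro q _; rw [← FreeGroup.one_eq_mk, mul_one]
  | cons x t ih =>
    intro q h
    rw [mk_cons, ← mul_assoc, ih]
    · by_contra hc
      rcases hd_step q x hc with h1 | h1
      · apply h 0 (by simp); simpa [← FreeGroup.one_eq_mk] using h1
      · apply h 1 (by simp); simpa [EL] using h1
    · intro j hj
      have := h (j + 1) (by simpa using hj)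
      rwa [List.take_succ_cons, mk_cons, ← mul_assoc] at this

theorem hd_mul_of_norm {k : ℕ} (p q : FG k) (h : FreeGroup.norm q < FreeGroup.norm p) : hd (p * q) = hd p := by
  have := hd_path (toWord q) p (by
    intro j hj hc
    have h1 : p = (FreeGroup.mk ((toWord q).take j))⁻¹ := eq_inv_of_mul_eq_one_left hc
    have h2 : FreeGroup.norm p ≤ FreeGroup.norm q := by
      rw [h1, norm_inv_eq]
      refine norm_mk_le.trans ?_
      simp [FreeGroup.norm]
    omega)
  rwa [mk_toWord] at this

/-- no cancellation -/
theorem toWord_mul_nc {k : ℕ} (p q : FG k) (h : ∀ c, hd p⁻¹ = some c → hd q ≠ some c) :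
    toWord (p * q) = toWord p ++ toWord q := by
  rw [toWord_mul]
  apply FreeGroup.IsReduced.reduce_eq
  apply red_append isReduced_toWord isReduced_toWord
  intro x hx y hy hyx
  have : hd p⁻¹ = some (linv x) := by
    rw [hd, toWord_inv, FreeGroup.invRev]
    rw [List.head?_reverse, List.getLast?_map, Option.mem_def.1 hx]
    rfl
  apply h _ this
  rw [hd, Option.mem_def.1 hy, hyx]

theorem norm_mul_nc {k : ℕ} (p q : FG k) (h : ∀ c, hd p⁻¹ = some c → hd q ≠ some c) :
    FreeGroup.norm (p * q) = FreeGroup.norm p + FreeGroup.norm q := by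
  rw [FreeGroup.norm, toWord_mul_nc p q h, List.length_append]; rfl

theorem hd_some {k : ℕ} {q : FG k} {d : Letter k} (h : hd q = some d) :
    ∃ t, toWord q = d :: t ∧ FreeGroup.IsReduced (d :: t) ∧ q = EL d * FreeGroup.mk t := by
  rw [hd] at h
  obtain ⟨t, ht⟩ : ∃ t, toWord q = d :: t := by
    cases hq : toWord q with
    | nil => simp [hq] at h
    | cons a t => simp [hq] at h; exact ⟨t, by rw [h]⟩
  refine ⟨t, ht, ht ▸ isReduced_toWord, ?_⟩
  rw [← mk_cons, ← ht, mk_toWord]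

theorem hd_mul_nc {k : ℕ} (p q : FG k) (hp : p ≠ 1) (h : ∀ c, hd p⁻¹ = some c → hd q ≠ some c) :
    hd (p * q) = hd p := by
  rw [hd, toWord_mul_nc p q h, List.head?_append_of_ne_nil]; rfl
  simpa using hp

theorem norm_mul_c {k : ℕ} (p : FG k) (d : Letter k) (h : hd p = some d) :
    FreeGroup.norm (EL (linv d) * p) + 1 = FreeGroup.norm p := by
  obtain ⟨t, h1, h2, h3⟩ := hd_some h
  rw [← EL_inv, h3, inv_mul_cancel_left, ← mk_cons, norm_mk_red h2,
    norm_mk_red ((red_append_iff (l := [d])).1 h2).2.1]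
  simp

theorem norm_mul_EL {k : ℕ} (p : FG k) (d : Letter k) (h : hd p ≠ some (linv d)) :
    FreeGroup.norm (EL d * p) = FreeGroup.norm p + 1 ∧ hd (EL d * p) = some d := by
  have hh : ∀ c, hd (EL d)⁻¹ = some c → hd p ≠ some c := by
    intro c hc; rw [EL_inv, hd_EL] at hc; cases hc; exact h
  refine ⟨?_, ?_⟩
  · rw [norm_mul_nc _ _ hh, norm_EL, add_comm]
  · rw [hd_mul_nc _ _ _ hh, hd_EL]
    intro h; have := norm_EL d; rw [h] at this; simp at this



/-- separated positions -/
def SS {k : ℕ} (f : FG k → Bool) (g : FG k) : Set (FG k) := {h | f h ≠ f (h * g)}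

noncomputable def NN {k : ℕ} (f : FG k → Bool) (g : FG k) : ℕ := (SS f g).ncard

/-- sum over adjacent pairs -/
def pairSum {k : ℕ} (F : Letter k → Letter k → ℕ) : List (Letter k) → ℕ
  | [] => 0
  | [_] => 0
  | x :: y :: t => F x y + pairSum F (y :: t)

def turnF {k : ℕ} (A : Letter k → Bool) (x y : Letter k) : ℕ := if A (linv x) ≠ A y then 1 else 0

def TT {k : ℕ} (A : Letter k → Bool) (g : FG k) : ℕ := pairSum (turnF A) (toWord g)

def degL {k : ℕ} (i : Fin k) (l : List (Letter k)) : ℕ := l.countP (fun x => decide (x.1 = i))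

def deg {k : ℕ} (i : Fin k) (g : FG k) : ℕ := degL i (toWord g)

theorem pairSum_eq {k : ℕ} (F : Letter k → Letter k → ℕ) (d : Letter k) : ∀ (l : List (Letter k)),
    pairSum F l = ∑ i ∈ Finset.range (l.length - 1), F (l.getD i d) (l.getD (i+1) d)
  | [] => by simp [pairSum]
  | [_] => by simp [pairSum]
  | x :: y :: t => by
    rw [pairSum, pairSum_eq F d (y :: t)]
    simp only [List.length_cons, Nat.add_sub_cancel]
    rw [Finset.sum_range_succ']
    simp only [List.getD_cons_succ, List.getD_cons_zero]
    exact Nat.add_comm _ _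

theorem pairSum_deg {k : ℕ} (c : Letter k) : ∀ (x : Letter k) (t : List (Letter k)),
    pairSum (fun x y => (if x = linv c then 1 else 0) + (if y = c then 1 else 0)) (x :: t)
      + (if x = c then 1 else 0) ≤ degL c.1 (x :: t)
  | x, [] => by
    simp only [pairSum, degL]
    split_ifs with h
    · simp [h]
    · simp
  | x, y :: t => by
    have ih := pairSum_deg c y t
    rw [pairSum]
    have : degL c.1 (x :: y :: t) = degL c.1 (y :: t) + if x.1 = c.1 then 1 else 0 := by
      simp [degL, List.countP_cons]
    rw [this]
    have h3 : (if x = linv c then 1 else 0) + (if x = c then 1 else 0) ≤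
      (if x.1 = c.1 then 1 else 0) := by
      by_cases h1 : x = linv c
      · subst h1; have h5 : (linv c).1 = c.1 := rfl
        simp [linv_ne, h5]
      · by_cases h2 : x = c
        · subst h2; simp [h1]
        · simp [h1, h2]
    omega

theorem pairSum_deg' {k : ℕ} (c : Letter k) (l : List (Letter k)) :
    pairSum (fun x y => (if x = linv c then 1 else 0) + (if y = c then 1 else 0)) l
      ≤ degL c.1 l := by
  cases l with
  | nil => simp [pairSum]
  | cons x t => have := pairSum_deg c x t; omega

/-- base point such that the segment passes through 1 at time j -/
def hpt {k : ℕ} (g : FG k) (j : ℕ) : FG k := (FreeGroup.mk ((toWord g).take j))⁻¹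

theorem hpt_mul {k : ℕ} (g : FG k) (j : ℕ) :
    hpt g j * g = FreeGroup.mk ((toWord g).drop j) := by
  conv_lhs => rw [← mk_toWord (x := g)]
  rw [hpt, toWord_mk, reduce_toWord, inv_mul_eq_iff_eq_mul, FreeGroup.mul_mk, List.take_append_drop]

theorem red_take {k : ℕ} (g : FG k) (j : ℕ) : FreeGroup.IsReduced ((toWord g).take j) :=
  isReduced_toWord.infix (List.take_prefix _ _).isInfix

theorem red_drop {k : ℕ} (g : FG k) (j : ℕ) : FreeGroup.IsReduced ((toWord g).drop j) :=
  isReduced_toWord.infix (List.drop_suffix _ _).isInfix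

theorem hpt_inj {k : ℕ} (g : FG k) : Set.InjOn (hpt g) (Finset.range (FreeGroup.norm g + 1)) := by
  intro i hi j hj h
  have h2 := congrArg FreeGroup.norm h
  rw [hpt, hpt, norm_inv_eq, norm_inv_eq, norm_mk_red (red_take _ _), norm_mk_red (red_take _ _)]
    at h2
  simp [FreeGroup.norm] at *
  omega

theorem hd_hpt {k : ℕ} (g : FG k) (d : Letter k) (i : ℕ) (hi : i + 1 < FreeGroup.norm g) :
    hd (hpt g (i+1)) = some (linv ((toWord g).getD i d)) ∧
    hd (hpt g (i+1) * g) = some ((toWord g).getD (i+1) d) := by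
  have hi' : i + 1 < (toWord g).length := hi
  constructor
  · rw [hd, hpt, toWord_inv, toWord_mk_red (red_take _ _), FreeGroup.invRev, List.head?_reverse,
      List.getLast?_map, List.getLast?_take]
    simp [List.getD, linv, List.getElem?_eq_getElem (show i < (toWord g).length by omega)]
  · rw [hpt_mul, hd, toWord_mk_red (red_drop _ _), List.head?_drop, List.getD,
      List.getElem?_eq_getElem hi']
    rfl

theorem hd_of_notin {k : ℕ} (g h : FG k) (hh : ∀ j ≤ FreeGroup.norm g, h ≠ hpt g j) :
    hd (h * g) = hd h := by
  conv_lhs => rw [← mk_toWord (x := g)]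
  apply hd_path
  intro j hj hc
  exact hh j hj (eq_inv_of_mul_eq_one_left hc)

open Classical in
theorem card_inter {k : ℕ} (g : FG k) (S : Set (FG k)) :
    (S ∩ ((Finset.range (FreeGroup.norm g + 1)).image (hpt g) : Finset (FG k))).ncard =
      ∑ j ∈ Finset.range (FreeGroup.norm g + 1), if hpt g j ∈ S then 1 else 0 := by
  have : S ∩ ((Finset.range (FreeGroup.norm g + 1)).image (hpt g) : Finset (FG k)) =
     (((Finset.range (FreeGroup.norm g + 1)).filter (fun j => hpt g j ∈ S)).image (hpt g) : Finset (FG k)) := by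
    ext x
    simp only [Set.mem_inter_iff, Finset.coe_image, Set.mem_image, Finset.coe_filter,
      Finset.mem_coe, Set.mem_ofPred_eq]
    constructor
    · rintro ⟨h1, j, h2, rfl⟩; exact ⟨j, ⟨h2, h1⟩, rfl⟩
    · rintro ⟨j, ⟨h2, h1⟩, rfl⟩; exact ⟨h1, j, h2, rfl⟩
  rw [this, Set.ncard_coe_finset, Finset.card_image_of_injOn, Finset.card_filter]
  exact (hpt_inj g).mono (by intro x hx; simp at hx ⊢; exact hx.1)

/-- local pruning -/
def prune {k : ℕ} (f : FG k → Bool) (c : Letter k) (q : FG k) : Bool :=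
  if hd q = some c then f q else f (EL (linv c))

def pruneA {k : ℕ} (f : FG k → Bool) (c : Letter k) (d : Letter k) : Bool :=
  decide (d ≠ c) && (f (EL d) == f (EL (linv c)))

open Classical in
theorem prune_sub {k : ℕ} (f : FG k → Bool) (c : Letter k) (g : FG k) :
    SS (prune f c) g \ ((Finset.range (FreeGroup.norm g + 1)).image (hpt g) : Finset (FG k)) ⊆
    SS f g \ ((Finset.range (FreeGroup.norm g + 1)).image (hpt g) : Finset (FG k)) := by
  rintro h ⟨h1, h2⟩
  refine ⟨?_, h2⟩
  have h3 := hd_of_notin g h (by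
    rintro j hj rfl
    apply h2
    simp only [Finset.coe_image, Set.mem_image]
    exact ⟨j, by simp; omega, rfl⟩)
  simp only [SS, Set.mem_ofPred_eq, prune, h3] at h1 ⊢
  by_cases hc : hd h = some c
  · simpa [hc] using h1
  · simp [hc] at h1

theorem prune_fin {k : ℕ} (f : FG k → Bool) (c : Letter k) (g : FG k) (hf : (SS f g).Finite) :
    (SS (prune f c) g).Finite := by
  classical
  have := prune_sub f c g
  refine ((hf.union (Finset.finite_toSet ((Finset.range (FreeGroup.norm g + 1)).image (hpt g))))).subset ?_
  intro x hx
  by_cases h : x ∈ (((Finset.range (FreeGroup.norm g + 1)).image (hpt g) : Finset (FG k)) : Set (FG k))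
  · exact Or.inr h
  · exact Or.inl (this ⟨hx, h⟩).1

theorem prune_le {k : ℕ} (f : FG k → Bool) (c : Letter k) (g : FG k) (hf : (SS f g).Finite)
    (hc : ∀ d, d ≠ c → ∀ q, hd q = some d → f q = f (EL d)) :
    NN (prune f c) g + TT (pruneA f c) g ≤ NN f g + deg c.1 g + 2 := by
  classical
  have hf' := prune_fin f c g hf
  have e1 := Set.ncard_inter_add_ncard_sdiff_eq_ncard (SS f g)
    ((Finset.range (FreeGroup.norm g + 1)).image (hpt g) : Finset (FG k)) hf
  have e2 := Set.ncard_inter_add_ncard_sdiff_eq_ncard (SS (prune f c) g)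
    ((Finset.range (FreeGroup.norm g + 1)).image (hpt g) : Finset (FG k)) hf'
  have e3 := Set.ncard_le_ncard (prune_sub f c g) hf.sdiff
  rw [card_inter] at e1 e2
  have hdeg := pairSum_deg' c (toWord g)
  have key : (∑ j ∈ Finset.range (FreeGroup.norm g + 1), if hpt g j ∈ SS (prune f c) g then 1 else 0)
      + TT (pruneA f c) g ≤ (∑ j ∈ Finset.range (FreeGroup.norm g + 1), if hpt g j ∈ SS f g then 1 else 0)
      + pairSum (fun x y => (if x = linv c then 1 else 0) + (if y = c then 1 else 0)) (toWord g)
      + 2 := by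
    rw [TT, pairSum_eq _ c, pairSum_eq _ c]
    change _ + ∑ i ∈ Finset.range (FreeGroup.norm g - 1), _ ≤ _ + ∑ i ∈ Finset.range (FreeGroup.norm g - 1), _ + 2
    have hle : ∀ p : Prop, (if p then 1 else 0) ≤ 1 := by intro p; split_ifs <;> simp
    obtain hn | ⟨n, hn⟩ : FreeGroup.norm g = 0 ∨ ∃ n, FreeGroup.norm g = n + 1 := by
      cases FreeGroup.norm g <;> simp
    · rw [hn]
      have := hle (hpt g 0 ∈ SS (prune f c) g)
      simp only [zero_add, Finset.sum_range_one, Nat.zero_sub, Finset.range_zero, Finset.sum_empty]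
      omega
    · rw [hn, Finset.sum_range_succ, Finset.sum_range_succ', Finset.sum_range_succ,
        Finset.sum_range_succ' _ n, Nat.add_sub_cancel]
      have h1 := hle (hpt g 0 ∈ SS (prune f c) g)
      have h2 := hle (hpt g (n+1) ∈ SS (prune f c) g)
      have h3 : ∑ i ∈ Finset.range n, (if hpt g (i + 1) ∈ SS (prune f c) g then 1 else 0) +
        ∑ i ∈ Finset.range n, turnF (pruneA f c) ((toWord g).getD i c) ((toWord g).getD (i + 1) c)
        ≤ ∑ i ∈ Finset.range n, (if hpt g (i + 1) ∈ SS f g then 1 else 0) +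
        ∑ i ∈ Finset.range n, ((if (toWord g).getD i c = linv c then 1 else 0) +
          (if (toWord g).getD (i+1) c = c then 1 else 0)) := by
        rw [← Finset.sum_add_distrib, ← Finset.sum_add_distrib]
        apply Finset.sum_le_sum
        intro i hi
        have hi' : i + 1 < FreeGroup.norm g := by have := Finset.mem_range.1 hi; omega
        obtain ⟨a1, a2⟩ := hd_hpt g c i hi'
        generalize (toWord g).getD i c = x at *
        generalize (toWord g).getD (i+1) c = y at *
        generalize hpt g (i+1) = p at *
        have hx : x = linv c ↔ linv x = c := by
          constructor
          · rintro rfl; exact linv_linv c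
          · rintro rfl; exact (linv_linv x).symm
        simp only [hx]
        simp only [turnF]
        generalize linv x = X at *
        have hX := fun h => hc X h p a1
        have hY := fun h => hc y h _ a2
        simp only [SS, Set.mem_ofPred_eq, prune, pruneA, a1, a2, Option.some.injEq]
        by_cases b1 : X = c <;> by_cases b2 : y = c
        · simp [b1, b2]; split_ifs <;> simp
        · have hY' := hY b2
          rcases Bool.eq_false_or_eq_true (f p) with q1 | q1 <;>
          rcases Bool.eq_false_or_eq_true (f (EL y)) with q2 | q2 <;>
          rcases Bool.eq_false_or_eq_true (f (EL (linv c))) with q3 | q3 <;>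
          simp [b1, b2, hY', q1, q2, q3]
        · have hX' := hX b1
          rcases Bool.eq_false_or_eq_true (f (p * g)) with q1 | q1 <;>
          rcases Bool.eq_false_or_eq_true (f (EL X)) with q2 | q2 <;>
          rcases Bool.eq_false_or_eq_true (f (EL (linv c))) with q3 | q3 <;>
          simp [b1, b2, hX', q1, q2, q3]
        · have hX' := hX b1
          have hY' := hY b2
          rcases Bool.eq_false_or_eq_true (f (EL y)) with q1 | q1 <;>
          rcases Bool.eq_false_or_eq_true (f (EL X)) with q2 | q2 <;>
          rcases Bool.eq_false_or_eq_true (f (EL (linv c))) with q3 | q3 <;>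
          simp [b1, b2, hX', hY', q1, q2, q3]
      omega
  simp only [NN, deg]
  omega

theorem final_le {k : ℕ} (f : FG k → Bool) (g : FG k) (hf : (SS f g).Finite)
    (hc : ∀ d, ∀ q, hd q = some d → f q = f (EL d)) :
    TT (fun d => f (EL d)) g ≤ NN f g := by
  classical
  have e1 := Set.ncard_inter_add_ncard_sdiff_eq_ncard (SS f g)
    ((Finset.range (FreeGroup.norm g + 1)).image (hpt g) : Finset (FG k)) hf
  rw [card_inter] at e1
  obtain hn | ⟨n, hn⟩ : FreeGroup.norm g = 0 ∨ ∃ n, FreeGroup.norm g = n + 1 := by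
      cases FreeGroup.norm g <;> simp
  · have : g = 1 := by simpa using hn
    subst this
    simp [TT, pairSum]
  have hne : toWord g ≠ [] := by
    intro h; rw [FreeGroup.norm, h] at hn; simp at hn
  let c := (toWord g).head hne
  have key : TT (fun d => f (EL d)) g ≤
      ∑ j ∈ Finset.range (FreeGroup.norm g + 1), if hpt g j ∈ SS f g then 1 else 0 := by
    rw [TT, pairSum_eq _ c]
    change ∑ i ∈ Finset.range (FreeGroup.norm g - 1), _ ≤ _
    rw [hn, Finset.sum_range_succ, Finset.sum_range_succ', Nat.add_sub_cancel]
    have h3 : ∑ i ∈ Finset.range n, turnF (fun d => f (EL d)) ((toWord g).getD i c)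
          ((toWord g).getD (i + 1) c)
        ≤ ∑ i ∈ Finset.range n, (if hpt g (i + 1) ∈ SS f g then 1 else 0) := by
      apply Finset.sum_le_sum
      intro i hi
      have hi' : i + 1 < FreeGroup.norm g := by have := Finset.mem_range.1 hi; omega
      obtain ⟨a1, a2⟩ := hd_hpt g c i hi'
      simp only [turnF, SS, Set.mem_ofPred_eq]
      simp only [hc _ _ a1, hc _ _ a2]
      split_ifs <;> simp_all
    omega
  simp only [NN]
  omega


theorem SS_trans {k : ℕ} (f : FG k → Bool) (u g : FG k) :
    SS (fun h => f (u * h)) g = (fun h => u⁻¹ * h) '' SS f g := by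
  ext x
  simp only [SS, Set.mem_image, Set.mem_ofPred_eq]
  constructor
  · intro h
    exact ⟨u * x, by simpa [mul_assoc] using h, by simp⟩
  · rintro ⟨y, h, rfl⟩
    simpa [mul_assoc] using h

theorem SS_trans_fin {k : ℕ} (f : FG k → Bool) (u g : FG k) (h : (SS f g).Finite) :
    (SS (fun h => f (u * h)) g).Finite := by
  rw [SS_trans]; exact h.image _

theorem NN_trans {k : ℕ} (f : FG k → Bool) (u g : FG k) :
    NN (fun h => f (u * h)) g = NN f g := by
  rw [NN, NN, SS_trans, Set.ncard_image_of_injective]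
  exact mul_right_injective _

theorem EL_pow {k : ℕ} (a : Letter k) (M : ℕ) :
    toWord (EL a ^ M) = List.replicate M a := by
  have : EL a ^ M = FreeGroup.mk (List.replicate M a) := by
    induction M with
    | zero => rfl
    | succ n ih => rw [pow_succ, ih, mk_append_EL, List.replicate_succ']
  rw [this, toWord_mk_red]
  rw [FreeGroup.IsReduced]
  apply List.isChain_replicate_of_rel
  simp

theorem desc_const {k : ℕ} (K : Finset (FG k)) (B : FG k → Bool)
    (hB : ∀ h x, h ∉ K → FreeGroup.norm (h * EL x) = FreeGroup.norm h + 1 → B (h * EL x) = B h)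
    (v : FG k) (hv : ∀ h ∈ K, FreeGroup.norm h ≤ FreeGroup.norm v)
    (q : FG k) (d : Letter k) (hq : hd q = some d) (hd' : hd v⁻¹ ≠ some d) :
    B (v * q) = B (v * EL d) := by
  obtain ⟨t, h1, h2, h3⟩ := hd_some hq
  rw [← mk_cons] at h3
  subst h3
  clear hq h1
  have hn : ∀ t, FreeGroup.IsReduced (d :: t) →
      FreeGroup.norm (v * FreeGroup.mk (d :: t)) = FreeGroup.norm v + (t.length + 1) := by
    intro t ht
    rw [norm_mul_nc, norm_mk_red ht, List.length_cons]
    intro c hc h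
    rw [hd, toWord_mk_red ht] at h
    simp at h
    subst h
    exact hd' hc
  induction t using List.reverseRecOn with
  | nil => rfl
  | append_singleton t x ih =>
    have h4 : FreeGroup.IsReduced (d :: t) := (red_append_iff (l := d :: t) (m := [x])).1 h2 |>.1
    rw [← ih h4]
    have e : v * FreeGroup.mk (d :: (t ++ [x])) = v * FreeGroup.mk (d :: t) * EL x := by
      rw [mul_assoc, mk_append_EL]; rfl
    have n1 := hn _ h2
    have n2 := hn _ h4
    rw [e] at n1 ⊢
    apply hB
    · intro hh
      have := hv _ hh
      omega
    · rw [n1, n2]; simp; omega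

theorem pow_agree {k : ℕ} (v : FG k) (c : Letter k) (hv : hd v⁻¹ = some c) (a : Letter k) (M : ℕ)
    (hM : FreeGroup.norm v < M) (h : hd (v⁻¹ * EL a ^ M) ≠ some c) :
    hd (v⁻¹ * EL a ^ M) = some (linv c) := by
  have e := toWord_mul_nc v (v⁻¹ * EL a ^ M) (by
    intro c' hc'; rw [hv] at hc'; cases hc'; exact h)
  rw [mul_inv_cancel_left, EL_pow] at e
  have e1 : ∀ x ∈ toWord v, x = a := by
    intro x hx
    have : x ∈ List.replicate M a := by rw [e]; simp [hx]
    exact List.eq_of_mem_replicate this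
  have e2 : ∀ x ∈ toWord (v⁻¹ * EL a ^ M), x = a := by
    intro x hx
    have : x ∈ List.replicate M a := by rw [e]; simp [hx]
    exact List.eq_of_mem_replicate this
  have hc : c = linv a := by
    have : c ∈ toWord v⁻¹ := List.mem_of_head? hv
    rw [toWord_inv, FreeGroup.invRev] at this
    simp only [List.mem_reverse, List.mem_map] at this
    obtain ⟨x, hx, rfl⟩ := this
    rw [e1 x hx]; rfl
  cases hh : hd (v⁻¹ * EL a ^ M) with
  | none =>
    have := congrArg List.length e
    rw [hd_none] at hh
    rw [hh] at this
    simp at this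
    simp only [FreeGroup.norm] at hM
    omega
  | some x =>
    rw [e2 x (List.mem_of_head? hh), hc, linv_linv]

theorem norm_mul_right_c {k : ℕ} (v : FG k) (c : Letter k) (hv : hd v⁻¹ = some c) :
    FreeGroup.norm (v * EL c) + 1 = FreeGroup.norm v := by
  have := norm_mul_c _ _ hv
  rw [← EL_inv, ← mul_inv_rev, norm_inv_eq, norm_inv_eq] at this
  exact this

theorem main_cut {k : ℕ} (g1 g2 : FG k) (C : ℕ)
    (H : ∀ (A : Letter k → Bool) c, A c ≠ A (linv c) →
      deg c.1 g1 + deg c.1 g2 ≤ TT A g1 + TT A g2 + C) (a : Letter k) (M : ℕ) :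
    ∀ (n : ℕ) (K : Finset (FG k)) (B : FG k → Bool), K.card = n → 1 ∈ K →
    (∀ h x, h * EL x ∈ K → FreeGroup.norm (h * EL x) = FreeGroup.norm h + 1 → h ∈ K) →
    (∀ h x, h ∉ K → FreeGroup.norm (h * EL x) = FreeGroup.norm h + 1 → B (h * EL x) = B h) →
    (∀ g, (SS B g).Finite) → (∀ h ∈ K, FreeGroup.norm h < M) →
    B (EL a ^ M) ≠ B (EL (linv a) ^ M) →
    deg a.1 g1 + deg a.1 g2 ≤ NN B g1 + NN B g2 + n * (C + 4) := by
  intro n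
  induction n with
  | zero =>
    intro K B hK h1
    rw [Finset.card_eq_zero] at hK
    rw [hK] at h1; simp at h1
  | succ n ih =>
    intro K B hK h1 hpre hB hfin hM hsep
    obtain ⟨v, hvK, hv⟩ := Finset.exists_max_image K FreeGroup.norm ⟨1, h1⟩
    by_cases hv1 : v = 1
    · subst hv1
      have hcone : ∀ d, ∀ q, hd q = some d → B q = B (EL d) := by
        intro d q hq
        have := desc_const K B hB 1 hv q d hq (by simp [hd_one])
        simpa using this
      have hM1 : 1 ≤ M := by have := hM 1 h1; omega
      have hp : ∀ b : Letter k, B (EL b ^ M) = B (EL b) := by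
        intro b
        apply hcone
        rw [hd, EL_pow, List.head?_replicate]; simp; omega
      rw [hp, hp] at hsep
      have l1 := final_le B g1 (hfin _) hcone
      have l2 := final_le B g2 (hfin _) hcone
      have := H (fun d => B (EL d)) a hsep
      have : C ≤ (n + 1) * (C + 4) := by nlinarith
      omega
    · obtain ⟨c, hc⟩ : ∃ c, hd v⁻¹ = some c := by
        cases h : hd v⁻¹ with
        | none => rw [hd_none] at h; simp at h; exact absurd h hv1
        | some c => exact ⟨c, rfl⟩
      have hcone : ∀ d, d ≠ c → ∀ q, hd q = some d → B (v * q) = B (v * EL d) := by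
        intro d hdc q hq
        apply desc_const K B hB v hv q d hq
        rw [hc]; intro h; apply hdc; simpa using h.symm
      have hlt : FreeGroup.norm (1 : FG k) < FreeGroup.norm v := by
        simp; exact Nat.pos_of_ne_zero (by simpa using hv1)
      let f : FG k → Bool := fun q => B (v * q)
      have hf : ∀ g, (SS f g).Finite := fun g => SS_trans_fin B v g (hfin g)
      have hNf : ∀ g, NN f g = NN B g := fun g => NN_trans B v g
      let B' : FG k → Bool := fun h => prune f c (v⁻¹ * h)
      have hB'v : ∀ h, hd (v⁻¹ * h) = some c → B' h = B h := by
        intro h hh; simp [B', prune, hh, f]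
      have hB'n : ∀ h, hd (v⁻¹ * h) ≠ some c → B' h = B (v * EL (linv c)) := by
        intro h hh; simp [B', prune, hh, f]
      have hf' : ∀ g, (SS B' g).Finite := fun g => SS_trans_fin _ _ _ (prune_fin f c g (hf g))
      have hN' : ∀ g, NN B' g = NN (prune f c) g := fun g => NN_trans (prune f c) v⁻¹ g
      have p1 := prune_le f c g1 (hf g1) hcone
      have p2 := prune_le f c g2 (hf g2) hcone
      rw [← hN', hNf] at p1 p2
      have hH := H (pruneA f c) c (by simp [pruneA, linv_ne])
      have hag : ∀ b : Letter k, B' (EL b ^ M) = B (EL b ^ M) := by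
        intro b
        by_cases hh : hd (v⁻¹ * EL b ^ M) = some c
        · exact hB'v _ hh
        · rw [hB'n _ hh]
          have := hcone _ (linv_ne c) _ (pow_agree v c hc b M (hM v hvK) hh)
          rw [mul_inv_cancel_left] at this
          exact this.symm
      have := ih (K.erase v) B' (by rw [Finset.card_erase_of_mem hvK, hK]; simp)
        (by rw [Finset.mem_erase]; exact ⟨fun h => hv1 h.symm, h1⟩)
        (by
          intro h x hx hn
          rw [Finset.mem_erase] at hx ⊢
          refine ⟨?_, hpre h x hx.2 hn⟩
          rintro rfl
          have := hv _ hx.2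
          omega)
        (by
          intro h x hx hn
          by_cases hhv : h = v
          · subst hhv
            rw [hB'n, hB'n]
            · rw [inv_mul_cancel, hd_one]; simp
            · rw [inv_mul_cancel_left, hd_EL]
              intro hxc
              simp at hxc
              subst hxc
              have := norm_mul_right_c _ _ hc
              omega
          · have hhK : h ∉ K := fun hh => hx (Finset.mem_erase.2 ⟨hhv, hh⟩)
            have hhx : h * EL x ≠ v := by
              rintro rfl
              exact hhK (hpre h x hvK hn)
            have hhd : hd (v⁻¹ * (h * EL x)) = hd (v⁻¹ * h) := by
              by_contra hcon
              rw [← mul_assoc] at hcon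
              rcases hd_step _ _ hcon with h5 | h5
              · apply hhv; rw [inv_mul_eq_one] at h5; exact h5.symm
              · apply hhx; rw [mul_assoc, inv_mul_eq_one] at h5; exact h5.symm
            by_cases hh : hd (v⁻¹ * h) = some c
            · rw [hB'v _ hh, hB'v _ (hhd.trans hh)]
              exact hB h x hhK hn
            · rw [hB'n _ hh, hB'n]
              rw [hhd]; exact hh)
        hf' (fun h hh => hM h (Finset.mem_of_mem_erase hh))
        (by rw [hag, hag]; exact hsep)
      have : (n + 1) * (C + 4) = n * (C+4) + (C + 4) := by ring
      omega


theorem norm_conj_le {k : ℕ} (x g : FG k) :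
    FreeGroup.norm g ≤ FreeGroup.norm (x * g * x⁻¹) + 2 * FreeGroup.norm x := by
  have h1 : g = x⁻¹ * (x * g * x⁻¹) * x := by group
  have h2 := FreeGroup.norm_mul_le (x⁻¹ * (x * g * x⁻¹)) x
  have h3 := FreeGroup.norm_mul_le x⁻¹ (x * g * x⁻¹)
  rw [← h1] at h2
  rw [norm_inv_eq] at h3
  omega

/-- the Whitehead power -/
def pw {k : ℕ} (a : Letter k) (b : Bool) : FG k := if b then EL a else 1

theorem pw_norm {k : ℕ} (a : Letter k) (b : Bool) : FreeGroup.norm (pw a b) ≤ 1 := by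
  cases b <;> simp [pw, norm_EL]

theorem pw_norm2 {k : ℕ} (a : Letter k) (b c : Bool) :
    FreeGroup.norm (pw a b * (pw a c)⁻¹) ≤ if b ≠ c then 1 else 0 := by
  cases b <;> cases c <;> simp [pw, norm_EL]

theorem of_eq_EL {k : ℕ} (j : Fin k) : FreeGroup.of j = EL (j, true) := rfl

theorem of_inv_eq_EL {k : ℕ} (j : Fin k) : (FreeGroup.of j)⁻¹ = EL (j, false) := by
  rw [of_eq_EL, EL_inv]; rfl

theorem lift_fix {k : ℕ} (F : Fin k → FG k) (a : Letter k) (h : F a.1 = FreeGroup.of a.1) :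
    FreeGroup.lift F (EL a) = EL a := by
  obtain ⟨i, b⟩ := a
  cases b
  · rw [← of_inv_eq_EL, _root_.map_inv, FreeGroup.lift_apply_of, h]
  · rw [← of_eq_EL, FreeGroup.lift_apply_of, h]

theorem lift_pw {k : ℕ} (F : Fin k → FG k) (a : Letter k) (b : Bool)
    (h : F a.1 = FreeGroup.of a.1) :
    FreeGroup.lift F (pw a b) = pw a b := by
  cases b
  · simp [pw]
  · simpa [pw] using lift_fix F a h

def wF {k : ℕ} (A : Letter k → Bool) (a : Letter k) (j : Fin k) : FG k :=
  if j = a.1 then FreeGroup.of j else (pw a (A (j, true)))⁻¹ * FreeGroup.of j * pw a (A (j, false))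

def wG {k : ℕ} (A : Letter k → Bool) (a : Letter k) (j : Fin k) : FG k :=
  if j = a.1 then FreeGroup.of j else pw a (A (j, true)) * FreeGroup.of j * (pw a (A (j, false)))⁻¹

/-- Whitehead automorphism -/
def wAut {k : ℕ} (A : Letter k → Bool) (a : Letter k) : MulAut (FG k) :=
  MonoidHom.toMulEquiv (FreeGroup.lift (wF A a)) (FreeGroup.lift (wG A a))
    (by
      ext j
      have hG : wG A a a.1 = FreeGroup.of a.1 := by simp [wG]
      by_cases h : j = a.1
      · subst h; simp [wF, wG]
      · simp only [MonoidHom.comp_apply, FreeGroup.lift_apply_of, wF, h, if_false, _root_.map_mul, _root_.map_inv,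
          lift_pw _ a _ hG]
        simp [wG, h]
        group)
    (by
      ext j
      have hG : wF A a a.1 = FreeGroup.of a.1 := by simp [wF]
      by_cases h : j = a.1
      · subst h; simp [wF, wG]
      · simp only [MonoidHom.comp_apply, FreeGroup.lift_apply_of, wG, h, if_false, _root_.map_mul, _root_.map_inv,
          lift_pw _ a _ hG]
        simp [wF, h]
        group)

theorem wAut_apply {k : ℕ} (A : Letter k → Bool) (a : Letter k) (g : FG k) :
    wAut A a g = FreeGroup.lift (wF A a) g := rfl

theorem wAut_EL1 {k : ℕ} (A : Letter k → Bool) (a : Letter k) (x : Letter k) (h : x.1 = a.1) :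
    wAut A a (EL x) = EL x := by
  rw [wAut_apply, lift_fix]
  simp [wF, h]

theorem wAut_EL2 {k : ℕ} (A : Letter k → Bool) (a : Letter k) (x : Letter k) (h : x.1 ≠ a.1) :
    wAut A a (EL x) = (pw a (A x))⁻¹ * EL x * pw a (A (linv x)) := by
  obtain ⟨j, b⟩ := x
  simp only at h
  cases b
  · rw [← of_inv_eq_EL, _root_.map_inv, wAut_apply, FreeGroup.lift_apply_of]
    simp [wF, h, linv, mul_assoc]
  · rw [← of_eq_EL, wAut_apply, FreeGroup.lift_apply_of]
    simp [wF, h, linv, mul_assoc]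

theorem wAut_EL {k : ℕ} (A : Letter k → Bool) (a : Letter k) (h0 : A a = false)
    (h1 : A (linv a) = true) (x : Letter k) :
    wAut A a (EL x) = (pw a (A x))⁻¹ * (if x.1 = a.1 then 1 else EL x) * pw a (A (linv x)) := by
  by_cases h : x.1 = a.1
  · rw [wAut_EL1 _ _ _ h]
    by_cases hx : x = a
    · subst hx; simp [pw, h0, h1]
    · have : x = linv a := by
        obtain ⟨j, b⟩ := x
        obtain ⟨i, c⟩ := a
        simp only at h
        subst h
        revert hx; cases b <;> cases c <;> simp [linv]
      rw [this, linv_linv]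
      have h5 : (linv a).1 = a.1 := rfl
      simp [h5, pw, h0, h1, EL_inv]
  · rw [wAut_EL2 _ _ _ h]; simp [h]

theorem wAut_wh {k : ℕ} (A : Letter k → Bool) (a : Letter k) : IsWhitehead2 (wAut A a) := by
  have hl : ∀ x : FG k, x ∈ letterSet k ↔ ∃ y : Letter k, x = EL y := by
    intro x
    constructor
    · rintro ⟨i, h | h⟩
      · exact ⟨(i, true), h⟩
      · exact ⟨(i, false), h.trans (of_inv_eq_EL i)⟩
    · rintro ⟨⟨i, b⟩, rfl⟩
      cases b
      · exact ⟨i, Or.inr (of_inv_eq_EL i).symm⟩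
      · exact ⟨i, Or.inl rfl⟩
  refine ⟨EL a, (hl _).2 ⟨a, rfl⟩, wAut_EL1 A a a rfl, ?_⟩
  intro x hx
  obtain ⟨y, rfl⟩ := (hl x).1 hx
  by_cases h : y.1 = a.1
  · exact Or.inl (wAut_EL1 A a y h)
  · rw [wAut_EL2 A a y h]
    cases A y <;> cases A (linv y) <;> simp [pw]

theorem wAut_norm_aux {k : ℕ} (A : Letter k → Bool) (a : Letter k) (h0 : A a = false)
    (h1 : A (linv a) = true) : ∀ (x : Letter k) (t : List (Letter k)),
    FreeGroup.norm (pw a (A x) * wAut A a (FreeGroup.mk (x :: t))) + degL a.1 (x :: t) ≤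
      (x :: t).length + pairSum (turnF A) (x :: t) + 1
  | x, [] => by
    have e : pw a (A x) * wAut A a (FreeGroup.mk [x]) =
      (if x.1 = a.1 then 1 else EL x) * pw a (A (linv x)) := by
      have := wAut_EL A a h0 h1 x
      rw [EL] at this; rw [this]; simp [mul_assoc, EL]
    rw [e]
    have h2 := FreeGroup.norm_mul_le (if x.1 = a.1 then 1 else EL x) (pw a (A (linv x)))
    have h3 := pw_norm a (A (linv x))
    have h4 : FreeGroup.norm (if x.1 = a.1 then (1 : FG k) else EL x) + degL a.1 [x] = 1 := by
      by_cases h : x.1 = a.1 <;> simp [h, degL, norm_EL]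
    simp only [List.length_singleton, pairSum]
    omega
  | x, y :: t => by
    have ih := wAut_norm_aux A a h0 h1 y t
    have e : pw a (A x) * wAut A a (FreeGroup.mk (x :: y :: t)) =
      (if x.1 = a.1 then 1 else EL x) * ((pw a (A (linv x)) * (pw a (A y))⁻¹) *
        (pw a (A y) * wAut A a (FreeGroup.mk (y :: t)))) := by
      rw [mk_cons, _root_.map_mul, wAut_EL A a h0 h1 x]; simp only [mul_assoc, mul_inv_cancel_left, inv_mul_cancel_left]
    rw [e]
    have h2 := FreeGroup.norm_mul_le (if x.1 = a.1 then 1 else EL x)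
      ((pw a (A (linv x)) * (pw a (A y))⁻¹) * (pw a (A y) * wAut A a (FreeGroup.mk (y :: t))))
    have h3 := FreeGroup.norm_mul_le (pw a (A (linv x)) * (pw a (A y))⁻¹)
      (pw a (A y) * wAut A a (FreeGroup.mk (y :: t)))
    have h4 : FreeGroup.norm (if x.1 = a.1 then (1 : FG k) else EL x) + degL a.1 (x :: y :: t)
        = 1 + degL a.1 (y :: t) := by
      by_cases h : x.1 = a.1 <;> simp [h, degL, norm_EL, List.countP_cons]
      · omega
    have h5 := pw_norm2 a (A (linv x)) (A y)
    rw [pairSum]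
    simp only [turnF, List.length_cons] at *
    omega

theorem wAut_norm {k : ℕ} (A : Letter k → Bool) (a : Letter k) (h0 : A a = false)
    (h1 : A (linv a) = true) (g : FG k) :
    FreeGroup.norm (wAut A a g) + deg a.1 g ≤ FreeGroup.norm g + TT A g + 2 := by
  cases h : toWord g with
  | nil =>
    rw [toWord_eq_nil_iff] at h
    subst h
    simp [deg, degL]
  | cons x t =>
    have := wAut_norm_aux A a h0 h1 x t
    rw [← h, mk_toWord] at this
    have h2 := FreeGroup.norm_mul_le (pw a (A x))⁻¹ (pw a (A x) * wAut A a g)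
    rw [inv_mul_cancel_left, norm_inv_eq] at h2
    have h3 := pw_norm a (A x)
    simp only [TT, deg]
    simp only [FreeGroup.norm] at *
    omega

theorem whitehead_bound {k : ℕ} (A : Letter k → Bool) (c : Letter k) (hA : A c ≠ A (linv c)) :
    ∃ τ : MulAut (FG k), IsWhitehead2 τ ∧
      ∀ g, FreeGroup.norm (τ g) + deg c.1 g ≤ FreeGroup.norm g + TT A g + 2 := by
  rcases Bool.eq_false_or_eq_true (A c) with h | h
  · refine ⟨wAut A (linv c), wAut_wh _ _, fun g => wAut_norm A (linv c) ?_ ?_ g⟩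
    · rw [h] at hA; simpa using hA.symm
    · rw [linv_linv, h]
  · refine ⟨wAut A c, wAut_wh _ _, fun g => wAut_norm A c h ?_ g⟩
    rw [h] at hA; simpa using hA.symm


theorem cr_iff {k : ℕ} (u : FG k) :
    _root_.IsCyclicallyReduced u ↔ FreeGroup.IsCyclicallyReduced (toWord u) := by
  have e : _root_.IsCyclicallyReduced u ↔ FreeGroup.IsReduced (toWord u ++ toWord u) := by
    rw [FreeGroup.isReduced_iff_reduce_eq]; rfl
  rw [e, red_append_iff, FreeGroup.isCyclicallyReduced_iff]
  constructor
  · rintro ⟨h1, _, h2⟩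
    exact ⟨h1, fun a ha b hb => (rel_iff a b).2 (h2 a ha b hb)⟩
  · rintro ⟨h1, h2⟩
    exact ⟨h1, h1, fun a ha b hb => (rel_iff a b).1 (h2 a ha b hb)⟩

theorem cr_toWord_pow {k : ℕ} (u : FG k) (hu : _root_.IsCyclicallyReduced u) (n : ℕ) :
    toWord (u ^ n) = (List.replicate n (toWord u)).flatten := by
  rw [toWord_pow, (((cr_iff u).1 hu).flatten_replicate n).isReduced.reduce_eq]

theorem cr_norm_pow {k : ℕ} (u : FG k) (hu : _root_.IsCyclicallyReduced u) (n : ℕ) :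
    FreeGroup.norm (u ^ n) = n * FreeGroup.norm u := by
  rw [FreeGroup.norm, cr_toWord_pow u hu]
  simp [FreeGroup.norm]

theorem cr_exists {k : ℕ} (g : FG k) :
    ∃ x u : FG k, _root_.IsCyclicallyReduced u ∧ g = x * u * x⁻¹ := by
  have h1 := reduceCyclically.isCyclicallyReduced (isReduced_toWord (x := g))
  refine ⟨FreeGroup.mk (reduceCyclically.conjugator (toWord g)),
    FreeGroup.mk (reduceCyclically (toWord g)), ?_, ?_⟩
  · rw [cr_iff, toWord_mk_red h1.isReduced]; exact h1
  · rw [FreeGroup.inv_mk, FreeGroup.mul_mk, FreeGroup.mul_mk,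
      reduceCyclically.conj_conjugator_reduceCyclically, mk_toWord]

theorem deg_le {k : ℕ} (i : Fin k) (g : FG k) : deg i g ≤ FreeGroup.norm g :=
  List.countP_le_length

theorem H_one {k : ℕ} (w : FG k) (hw : w ∈ SM k) (u : FG k)
    (hu : _root_.IsCyclicallyReduced u) (A : Letter k → Bool) (c : Letter k) :
    ∃ D : ℕ, A c ≠ A (linv c) → ∀ n m : ℕ, m = (FreeGroup.norm u + 1) * n →
      deg c.1 (w ^ m) + deg c.1 (u ^ n) ≤ TT A (w ^ m) + TT A (u ^ n) + D := by
  by_cases hA : A c ≠ A (linv c)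
  swap
  · exact ⟨0, fun h => absurd h hA⟩
  obtain ⟨τ, h1, h2⟩ := whitehead_bound A c hA
  by_cases hin : IsInner τ
  · obtain ⟨x, rfl⟩ := hin
    refine ⟨4 + 4 * FreeGroup.norm x, fun _ n m hm => ?_⟩
    have a1 := h2 (w ^ m)
    have a2 := h2 (u ^ n)
    rw [MulAut.conj_apply] at a1 a2
    have a3 := norm_conj_le x (w ^ m)
    have a4 := norm_conj_le x (u ^ n)
    omega
  · have h3 := hw.2 τ h1 hin
    have h4 : cyclicLength (τ w) ∈ {n | ∃ x u : FG k, _root_.IsCyclicallyReduced u ∧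
        τ w = x * u * x⁻¹ ∧ wordLength u = n} := by
      apply Nat.sInf_mem
      obtain ⟨x, u, h5, h6⟩ := cr_exists (τ w)
      exact ⟨_, x, u, h5, h6, rfl⟩
    obtain ⟨x, v, h5, h6, h7⟩ := h4
    refine ⟨2 + 2 * FreeGroup.norm x, fun _ n m hm => ?_⟩
    have a1 := h2 (w ^ m)
    have a2 : τ (w ^ m) = x * v ^ m * x⁻¹ := by rw [map_pow, h6, conj_pow]
    have a3 := norm_conj_le x (v ^ m)
    rw [← a2, cr_norm_pow v h5] at a3
    rw [cr_norm_pow w hw.1] at a1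
    have a4 := deg_le c.1 (u ^ n)
    rw [cr_norm_pow u hu] at a4
    have a5 : FreeGroup.norm w + 1 ≤ FreeGroup.norm v := by
      change FreeGroup.norm w < _ at h3
      change FreeGroup.norm v = _ at h7
      omega
    have a6 : m * (FreeGroup.norm w + 1) ≤ m * FreeGroup.norm v := Nat.mul_le_mul_left _ a5
    have a7 : n * FreeGroup.norm u ≤ m := by rw [hm]; nlinarith
    rw [Nat.mul_add] at a6
    omega

theorem H_exists {k : ℕ} (w : FG k) (hw : w ∈ SM k) (u : FG k)
    (hu : _root_.IsCyclicallyReduced u) :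
    ∃ C : ℕ, ∀ n m : ℕ, m = (FreeGroup.norm u + 1) * n →
      ∀ (A : Letter k → Bool) (c : Letter k), A c ≠ A (linv c) →
      deg c.1 (w ^ m) + deg c.1 (u ^ n) ≤ TT A (w ^ m) + TT A (u ^ n) + C := by
  classical
  choose D hD using H_one w hw u hu
  refine ⟨∑ A, ∑ c, D A c, fun n m hm A c hA => ?_⟩
  have h1 := hD A c hA n m hm
  have h2 : D A c ≤ ∑ c, D A c := Finset.single_le_sum (f := fun c => D A c) (fun _ _ => Nat.zero_le _) (Finset.mem_univ c)
  have h3 : ∑ c, D A c ≤ ∑ A, ∑ c, D A c :=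
    Finset.single_le_sum (f := fun A => ∑ c, D A c) (fun _ _ => Nat.zero_le _) (Finset.mem_univ A)
  omega


def Hy {k : ℕ} (y : Fin k) (q : FG k) : Bool := decide (hd q = some (y, true))

theorem SS_mul_sub {k : ℕ} (f : FG k → Bool) (g g' : FG k) :
    SS f (g * g') ⊆ SS f g ∪ (fun h => h * g⁻¹) '' SS f g' := by
  intro h hh
  by_cases h1 : h ∈ SS f g
  · exact Or.inl h1
  · refine Or.inr ⟨h * g, ?_, by simp⟩
    simp only [SS, Set.mem_ofPred_eq, ne_eq, not_not] at *
    rw [← h1, mul_assoc]; exact hh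

theorem NN_mul_le {k : ℕ} (f : FG k → Bool) (g g' : FG k) (h1 : (SS f g).Finite)
    (h2 : (SS f g').Finite) : (SS f (g * g')).Finite ∧ NN f (g * g') ≤ NN f g + NN f g' := by
  have h3 := h1.union (h2.image (fun h => h * g⁻¹))
  refine ⟨h3.subset (SS_mul_sub f g g'), ?_⟩
  refine (Set.ncard_le_ncard (SS_mul_sub f g g') h3).trans ((Set.ncard_union_le _ _).trans ?_)
  exact Nat.add_le_add_left (Set.ncard_image_le h2) _

theorem SSH_EL {k : ℕ} (y : Fin k) (x : Letter k) :
    SS (Hy y) (EL x) ⊆ if x.1 = y then {if x.2 then 1 else EL (linv x)} else ∅ := by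
  intro h hh
  simp only [SS, Set.mem_ofPred_eq] at hh
  have h1 : hd (h * EL x) ≠ hd h := by
    intro h2; apply hh; simp [Hy, h2]
  obtain ⟨j, b⟩ := x
  rcases hd_step h _ h1 with h2 | h2
  · subst h2
    rw [one_mul] at hh
    simp only [Hy, hd_one, hd_EL] at hh
    simp at hh
    simp [hh.1, hh.2]
  · have h3 : h = EL (linv (j, b)) := by rw [← EL_inv]; exact eq_inv_of_mul_eq_one_left h2
    rw [h2, h3] at hh
    simp only [Hy, hd_one, hd_EL] at hh
    simp [linv] at hh
    simp [hh.1, hh.2, h3]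

theorem SSH_list {k : ℕ} (y : Fin k) : ∀ l : List (Letter k),
    (SS (Hy y) (FreeGroup.mk l)).Finite ∧ NN (Hy y) (FreeGroup.mk l) ≤ degL y l
  | [] => by
    have : SS (Hy y) (FreeGroup.mk []) = ∅ := by
      ext h; simp [SS, ← FreeGroup.one_eq_mk]
    rw [NN, this]; simp
  | x :: t => by
    have ih := SSH_list y t
    have h0 := SSH_EL y x
    have h1 : (SS (Hy y) (EL x)).Finite ∧ NN (Hy y) (EL x) ≤ if x.1 = y then 1 else 0 := by
      by_cases hx : x.1 = y
      · rw [if_pos hx] at h0 ⊢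
        refine ⟨(Set.finite_singleton _).subset h0, ?_⟩
        exact (Set.ncard_le_ncard h0 (Set.finite_singleton _)).trans (by simp)
      · rw [if_neg hx] at h0 ⊢
        refine ⟨Set.finite_empty.subset h0, ?_⟩
        exact (Set.ncard_le_ncard h0 Set.finite_empty).trans (by simp)
    have h2 := NN_mul_le (Hy y) (EL x) (FreeGroup.mk t) h1.1 ih.1
    rw [mk_cons]
    refine ⟨h2.1, h2.2.trans ?_⟩
    have : degL y (x :: t) = degL y t + if x.1 = y then 1 else 0 := by
      simp [degL, List.countP_cons]
    omega

theorem SSH_fin {k : ℕ} (y : Fin k) (g : FG k) : (SS (Hy y) g).Finite := by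
  have := (SSH_list y (toWord g)).1
  rwa [mk_toWord] at this

theorem NNH_le {k : ℕ} (y : Fin k) (g : FG k) : NN (Hy y) g ≤ deg y g := by
  have := (SSH_list y (toWord g)).2
  rwa [mk_toWord] at this

theorem sum_deg {k : ℕ} (g : FG k) : ∑ y, deg y g = FreeGroup.norm g := by
  simp only [deg, FreeGroup.norm]
  induction toWord g with
  | nil => simp [degL]
  | cons x t ih =>
    have : ∀ y, degL y (x :: t) = degL y t + if x.1 = y then 1 else 0 := by
      intro y; simp [degL, List.countP_cons]
    simp only [this, Finset.sum_add_distrib, ih]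
    simp

def By {k : ℕ} (α : MulAut (FG k)) (t : FG k) (y : Fin k) (h : FG k) : Bool := Hy y (t * α h)

theorem SSB {k : ℕ} (α : MulAut (FG k)) (t : FG k) (y : Fin k) (g : FG k) :
    SS (By α t y) g = (fun q => α.symm (t⁻¹ * q)) '' SS (Hy y) (α g) := by
  ext x
  simp only [SS, By, Set.mem_image, Set.mem_ofPred_eq]
  constructor
  · intro h
    refine ⟨t * α x, by simpa [mul_assoc] using h, by simp⟩
  · rintro ⟨q, h, rfl⟩
    simpa [mul_assoc] using h

theorem SSB_fin {k : ℕ} (α : MulAut (FG k)) (t : FG k) (y : Fin k) (g : FG k) :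
    (SS (By α t y) g).Finite := by
  rw [SSB]; exact (SSH_fin _ _).image _

theorem NNB_le {k : ℕ} (α : MulAut (FG k)) (t : FG k) (y : Fin k) (g : FG k) :
    NN (By α t y) g ≤ deg y (α g) := by
  rw [NN, SSB]
  exact (Set.ncard_image_le (SSH_fin _ _)).trans (NNH_le _ _)

theorem ball_fin {k : ℕ} (R : ℕ) : {g : FG k | FreeGroup.norm g ≤ R}.Finite := by
  have h := List.finite_length_le (Letter k) R
  exact Set.Finite.of_injOn (f := toWord) (t := {l : List (Letter k) | l.length ≤ R})
    (fun g hg => hg) (toWord_injective.injOn) h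

/-- one cut -/
theorem one_cut {k : ℕ} (α : MulAut (FG k)) (a : Letter k) (y : Fin k) (t : FG k) (M0 : ℕ)
    (hsep : ∀ M, M0 ≤ M → Hy y (t * α (EL a) ^ M) ≠ Hy y (t * (α (EL a))⁻¹ ^ M)) :
    ∃ D : ℕ, ∀ (g1 g2 : FG k) (C : ℕ)
    (_ : ∀ (A : Letter k → Bool) c, A c ≠ A (linv c) →
      deg c.1 g1 + deg c.1 g2 ≤ TT A g1 + TT A g2 + C),
      deg a.1 g1 + deg a.1 g2 ≤ deg y (α g1) + deg y (α g2) + D * (C + 4) := by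
  have hU : (⋃ x : Letter k, SS (By α t y) (EL x)).Finite :=
    Set.finite_iUnion fun x => SSB_fin α t y _
  obtain ⟨R, hR⟩ : ∃ R, ∀ h ∈ ⋃ x : Letter k, SS (By α t y) (EL x), FreeGroup.norm h ≤ R := by
    obtain ⟨R, hR⟩ := (hU.image FreeGroup.norm).bddAbove
    exact ⟨R, fun h hh => hR ⟨h, hh, rfl⟩⟩
  have hmem : ∀ h, h ∈ (ball_fin (k := k) R).toFinset ↔ FreeGroup.norm h ≤ R := by
    intro h; simp
  refine ⟨(ball_fin (k := k) R).toFinset.card, fun g1 g2 C H => ?_⟩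
  have := main_cut g1 g2 C H a (R + M0 + 1) _ (ball_fin (k := k) R).toFinset (By α t y) rfl
    (by rw [hmem]; simp)
    (by intro h x; rw [hmem, hmem]; omega)
    (by
      intro h x hh _
      rw [hmem] at hh
      by_contra hc
      exact hh (hR h (Set.mem_iUnion.2 ⟨x, fun e => hc e.symm⟩)))
    (SSB_fin α t y)
    (by intro h; rw [hmem]; omega)
    (by
      simp only [By]
      rw [← EL_inv, map_pow, map_pow, _root_.map_inv]
      exact hsep _ (by omega))
  have h1 := NNB_le α t y g1
  have h2 := NNB_le α t y g2
  omega

/-- exponent homomorphism -/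
def eh {k : ℕ} (y : Fin k) : FG k →* Multiplicative ℤ :=
  FreeGroup.lift (fun j => if j = y then Multiplicative.ofAdd 1 else 1)

theorem eh_mem {k : ℕ} (y : Fin k) (l : List (Letter k)) (h : eh y (FreeGroup.mk l) ≠ 1) :
    ∃ b, (y, b) ∈ l := by
  by_contra hc
  push Not at hc
  apply h
  induction l with
  | nil => rw [← FreeGroup.one_eq_mk, _root_.map_one]
  | cons x t ih =>
    have hx : x.1 ≠ y := by
      intro hx; apply hc x.2; rw [← hx]; simp
    have ht : eh y (FreeGroup.mk t) = 1 := by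
      by_contra h2
      exact h2 (ih h2 (fun b hb => hc b (by simp [hb])))
    have hx2 : eh y (EL x) = 1 := by
      obtain ⟨j, b⟩ := x
      simp only at hx
      cases b
      · rw [← of_inv_eq_EL, _root_.map_inv, eh, FreeGroup.lift_apply_of]; simp [hx]
      · rw [← of_eq_EL, eh, FreeGroup.lift_apply_of]; simp [hx]
    rw [mk_cons, _root_.map_mul, ht, hx2, one_mul]

theorem sep {k : ℕ} (p : FG k) (y : Fin k) (hp : eh y p ≠ 1) :
    ∃ (t : FG k) (M0 : ℕ), ∀ M, M0 ≤ M → Hy y (t * p ^ M) ≠ Hy y (t * p⁻¹ ^ M) := by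
  obtain ⟨r, s, hs, rfl⟩ := cr_exists p
  have h1 : eh y s ≠ 1 := by
    intro h; apply hp; simp [h]
  rw [← mk_toWord (x := s)] at h1
  obtain ⟨ε, hε⟩ := eh_mem y _ h1
  obtain ⟨s1, s2, he⟩ := List.append_of_mem hε
  have hred : FreeGroup.IsReduced (((y, ε) :: s2 ++ s1) ++ ((y, ε) :: s2 ++ s1)) := by
    have h3 := ((cr_iff s).1 hs).flatten_replicate 3 |>.isReduced
    refine h3.infix ⟨s1, (y, ε) :: s2, ?_⟩
    simp [List.replicate, he]
  have hred1 : FreeGroup.IsReduced ((y, ε) :: s2 ++ s1) := (red_append_iff.1 hred).1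
  obtain ⟨s', hs'⟩ : ∃ s', s' = FreeGroup.mk ((y, ε) :: s2 ++ s1) := ⟨_, rfl⟩
  have hw' : toWord s' = (y, ε) :: s2 ++ s1 := by rw [hs', toWord_mk_red hred1]
  have hcr : _root_.IsCyclicallyReduced s' := by
    change reduce _ = _
    rw [hw']
    exact hred.reduce_eq
  obtain ⟨r', hr'⟩ : ∃ r', r' = r * FreeGroup.mk s1 := ⟨_, rfl⟩
  have hconj : r * s * r⁻¹ = r' * s' * r'⁻¹ := by
    have e1 : s = FreeGroup.mk s1 * FreeGroup.mk ((y, ε) :: s2) := by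
      rw [FreeGroup.mul_mk, ← he, mk_toWord]
    have e2 : s' = FreeGroup.mk ((y, ε) :: s2) * FreeGroup.mk s1 := by
      rw [FreeGroup.mul_mk, hs']
    rw [hr', e1, e2]; group
  rw [hconj]
  have hpos : 1 ≤ FreeGroup.norm s' := by rw [FreeGroup.norm, hw']; simp
  have A1 : ∀ M, FreeGroup.norm r' + 1 ≤ M → hd (s' ^ M * r'⁻¹) = some (y, ε) := by
    intro M hM
    rw [hd_mul_of_norm]
    · rw [hd, cr_toWord_pow s' hcr]
      obtain ⟨n, rfl⟩ : ∃ n, M = n + 1 := ⟨M - 1, by omega⟩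
      rw [List.replicate_succ, List.flatten_cons, hw']; simp
    · rw [cr_norm_pow s' hcr, norm_inv_eq]; nlinarith
  have A2 : ∀ M, FreeGroup.norm r' + 1 ≤ M → hd ((s' ^ M)⁻¹ * r'⁻¹) ≠ some (y, ε) := by
    intro M hM
    rw [hd_mul_of_norm]
    · intro hh
      have h5 := norm_mul_right_c _ _ hh
      have h6 : hd (s' ^ M) = some (y, ε) := by
        rw [hd, cr_toWord_pow s' hcr]
        obtain ⟨n, rfl⟩ : ∃ n, M = n + 1 := ⟨M - 1, by omega⟩
        rw [List.replicate_succ, List.flatten_cons, hw']; simp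
      have h7 := norm_mul_c _ _ h6
      have h8 := FreeGroup.norm_mul_le (s' ^ M * EL (y, ε)) (EL (linv (y, ε)) * s' ^ M)
      have e : s' ^ M * EL (y, ε) * (EL (linv (y, ε)) * s' ^ M) = s' ^ (M + M) := by
        rw [← EL_inv, pow_add]; group
      rw [e, cr_norm_pow s' hcr] at h8
      rw [cr_norm_pow s' hcr] at h5 h7
      have : (M + M) * FreeGroup.norm s' = M * FreeGroup.norm s' + M * FreeGroup.norm s' := by ring
      omega
    · rw [norm_inv_eq, norm_inv_eq, cr_norm_pow s' hcr]; nlinarith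
  have e1 : ∀ M, r'⁻¹ * (r' * s' * r'⁻¹) ^ M = s' ^ M * r'⁻¹ := by
    intro M; rw [conj_pow]; group
  have e2 : ∀ M, r'⁻¹ * (r' * s' * r'⁻¹)⁻¹ ^ M = (s' ^ M)⁻¹ * r'⁻¹ := by
    intro M; rw [inv_pow, conj_pow]; group
  cases ε
  · refine ⟨EL (y, true) * r'⁻¹, FreeGroup.norm r' + 1, fun M hM => ?_⟩
    rw [mul_assoc (EL (y, true)), mul_assoc (EL (y, true)), e1, e2]
    have B1 := A1 M hM
    have B2 := norm_mul_EL _ (y, true) (A2 M hM)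
    have B3 : hd (EL (y, true) * (s' ^ M * r'⁻¹)) ≠ some (y, true) := by
      intro hh
      have c1 := norm_mul_c _ _ hh
      have c2 := norm_mul_c _ _ B1
      rw [← EL_inv, inv_mul_cancel_left] at c1
      have : linv (y, false) = (y, true) := rfl
      rw [this] at c2
      omega
    simp [Hy, B2.2, B3]
  · refine ⟨r'⁻¹, FreeGroup.norm r' + 1, fun M hM => ?_⟩
    rw [e1, e2]
    simp [Hy, A1 M hM, A2 M hM]


def eM {k : ℕ} (α : MulAut (FG k)) : Matrix (Fin k) (Fin k) ℤ :=
  fun i y => Multiplicative.toAdd (eh y (α (FreeGroup.of i)))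

theorem eh_of {k : ℕ} (y j : Fin k) :
    Multiplicative.toAdd (eh y (FreeGroup.of j)) = if j = y then 1 else 0 := by
  rw [eh, FreeGroup.lift_apply_of]; split_ifs <;> simp

theorem eh_aut {k : ℕ} (α : MulAut (FG k)) (y : Fin k) (g : FG k) :
    Multiplicative.toAdd (eh y (α g)) = ∑ j, Multiplicative.toAdd (eh j g) * eM α j y := by
  induction g using FreeGroup.induction_on with
  | C1 => simp
  | of i => simp [eh_of, eM]
  | inv_of i h => simp at h ⊢; exact h
  | mul a b ha hb =>
    simp only [_root_.map_mul, toAdd_mul, ha, hb, add_mul, Finset.sum_add_distrib]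

theorem eM_perm {k : ℕ} (α : MulAut (FG k)) :
    ∃ σ : Equiv.Perm (Fin k), ∀ y, eh y (α (FreeGroup.of (σ y))) ≠ 1 := by
  have h1 : eM α⁻¹ * eM α = 1 := by
    ext i y
    rw [Matrix.mul_apply]
    have := eh_aut α y (α⁻¹ (FreeGroup.of i))
    rw [MulAut.apply_inv_self, eh_of] at this
    rw [Matrix.one_apply, this]; rfl
  have h2 : (eM α).det ≠ 0 := by
    intro h
    have := congrArg Matrix.det h1
    rw [Matrix.det_mul, h, mul_zero, Matrix.det_one] at this
    exact zero_ne_one this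
  rw [Matrix.det_apply] at h2
  obtain ⟨σ, _, hσ⟩ := Finset.exists_ne_zero_of_sum_ne_zero h2
  refine ⟨σ, fun y hy => hσ ?_⟩
  rw [Finset.prod_eq_zero (Finset.mem_univ y), smul_zero]
  simp [eM, hy]

theorem key_ineq {k : ℕ} (w : FG k) (hw : w ∈ SM k) (u : FG k)
    (hu : _root_.IsCyclicallyReduced u) (α : MulAut (FG k)) :
    ∃ C : ℕ, ∀ n m : ℕ, m = (FreeGroup.norm u + 1) * n →
      m * FreeGroup.norm w + n * FreeGroup.norm u ≤
        FreeGroup.norm (α w ^ m) + FreeGroup.norm (α u ^ n) + C := by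
  obtain ⟨C, hC⟩ := H_exists w hw u hu
  obtain ⟨σ, hσ⟩ := eM_perm α
  have h1 : ∀ y : Fin k, ∃ D : ℕ, ∀ (g1 g2 : FG k) (C : ℕ)
    (_ : ∀ (A : Letter k → Bool) c, A c ≠ A (linv c) →
      deg c.1 g1 + deg c.1 g2 ≤ TT A g1 + TT A g2 + C),
      deg (σ y) g1 + deg (σ y) g2 ≤ deg y (α g1) + deg y (α g2) + D * (C + 4) := by
    intro y
    obtain ⟨t, M0, h⟩ := sep (α (FreeGroup.of (σ y))) y (hσ y)
    exact one_cut α (σ y, true) y t M0 h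
  choose D hD using h1
  refine ⟨∑ y, D y * (C + 4), fun n m hm => ?_⟩
  have h2 := Finset.sum_le_sum (fun y (_ : y ∈ Finset.univ) =>
    hD y (w ^ m) (u ^ n) C (hC n m hm))
  simp only [Finset.sum_add_distrib, sum_deg] at h2
  rw [Equiv.sum_comp σ (fun y => deg y (w ^ m)), Equiv.sum_comp σ (fun y => deg y (u ^ n)),
    sum_deg, sum_deg, cr_norm_pow w hw.1, cr_norm_pow u hu, map_pow, map_pow] at h2
  exact h2

theorem norm_conj_le' {k : ℕ} (x g : FG k) :
    FreeGroup.norm (x * g * x⁻¹) ≤ FreeGroup.norm g + 2 * FreeGroup.norm x := by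
  have h2 := FreeGroup.norm_mul_le (x * g) x⁻¹
  have h3 := FreeGroup.norm_mul_le x g
  rw [norm_inv_eq] at h2
  omega

theorem arch {a b C : ℕ} (h : ∀ n : ℕ, n * a ≤ n * b + C) : a ≤ b := by
  by_contra hc
  push Not at hc
  have := h (C + 1)
  nlinarith

theorem len_ge {k : ℕ} (w : FG k) (hw : w ∈ SM k) (α : MulAut (FG k)) (x : FG k)
    (hα : α w = x * w * x⁻¹) (u v z : FG k) (hu : _root_.IsCyclicallyReduced u)
    (hv : _root_.IsCyclicallyReduced v) (h : α u = z * v * z⁻¹) :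
    FreeGroup.norm u ≤ FreeGroup.norm v := by
  obtain ⟨C, hC⟩ := key_ineq w hw u hu α
  apply arch (C := C + 2 * FreeGroup.norm x + 2 * FreeGroup.norm z)
  intro n
  have h1 := hC n _ rfl
  rw [hα, h, conj_pow, conj_pow] at h1
  have h2 := norm_conj_le' x (w ^ ((FreeGroup.norm u + 1) * n))
  have h3 := norm_conj_le' z (v ^ n)
  rw [cr_norm_pow w hw.1] at h2
  rw [cr_norm_pow v hv] at h3
  omega

theorem len_le {k : ℕ} (w : FG k) (hw : w ∈ SM k) (α : MulAut (FG k)) (x : FG k)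
    (hα : α w = x * w * x⁻¹) (u : FG k) (hu : _root_.IsCyclicallyReduced u) :
    ∃ v z, _root_.IsCyclicallyReduced v ∧ α u = z * v * z⁻¹ ∧
    FreeGroup.norm v ≤ FreeGroup.norm u := by
  obtain ⟨z, v, hv, h⟩ := cr_exists (α u)
  refine ⟨v, z, hv, h, ?_⟩
  apply len_ge w hw α⁻¹ (α⁻¹ x)⁻¹ _ v u (α⁻¹ z)⁻¹ hv hu
  · apply α.injective
    rw [MulAut.apply_inv_self]
    simp [h]; group
  · apply α.injective
    simp [hα]; group


theorem cr_len_le {k : ℕ} (P v t : FG k) (hP : _root_.IsCyclicallyReduced P)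
    (hv : _root_.IsCyclicallyReduced v) (h : P = t * v * t⁻¹) :
    FreeGroup.norm P ≤ FreeGroup.norm v := by
  apply arch (C := 2 * FreeGroup.norm t)
  intro n
  have h1 := norm_conj_le' t (v ^ n)
  rw [← conj_pow, ← h, cr_norm_pow P hP, cr_norm_pow v hv] at h1
  exact h1

theorem cr_of_nc {k : ℕ} (P : FG k) (h : hd P⁻¹ ≠ hd P) : _root_.IsCyclicallyReduced P := by
  change reduce _ = _
  have := toWord_mul_nc P P (by
    intro c hc h2; apply h; rw [hc, h2])
  rw [← this]
  conv_rhs => rw [← reduce_toWord]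

theorem EL_idx {k : ℕ} (d z : Letter k) (h : d.1 = z.1) : ∃ e : ℤ, EL d = EL z ^ e := by
  obtain ⟨i, b⟩ := d
  obtain ⟨j, c⟩ := z
  simp only at h
  subst h
  by_cases hbc : b = c
  · exact ⟨1, by simp [hbc]⟩
  · refine ⟨-1, ?_⟩
    rw [zpow_neg_one, EL_inv]
    congr 1
    revert hbc; cases b <;> cases c <;> simp [linv]

theorem comm_idx {k : ℕ} (d z : Letter k) (h : d.1 = z.1) : Commute (EL d) (EL z) := by
  obtain ⟨e, he⟩ := EL_idx d z h
  rw [he]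
  exact (Commute.refl (EL z)).zpow_left e

theorem big_cr {k : ℕ} (z z' : Letter k) (g : FG k) (hg : g ≠ 1)
    (h1 : ∀ d, hd g = some d → d.1 ≠ z.1) (h2 : ∀ d, hd g⁻¹ = some d → d.1 ≠ z'.1) :
    _root_.IsCyclicallyReduced (EL z * (g * (EL z' * g⁻¹))) ∧
    FreeGroup.norm (EL z * (g * (EL z' * g⁻¹))) = 2 + 2 * FreeGroup.norm g := by
  have a1 : ∀ x : Letter k, x.1 = z.1 → hd g ≠ some x := fun x hx h => h1 x h hx
  have a2 : ∀ x : Letter k, x.1 = z'.1 → hd g⁻¹ ≠ some x := fun x hx h => h2 x h hx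
  have n1 := norm_mul_EL g⁻¹ z' (a2 _ rfl)
  have c1 : ∀ c, hd g⁻¹ = some c → hd (EL z' * g⁻¹) ≠ some c := by
    intro c hc hh
    rw [n1.2] at hh
    exact a2 z' rfl (hc.trans hh.symm)
  have n2 := norm_mul_nc g _ c1
  have n2' := hd_mul_nc g _ hg c1
  have n3 := norm_mul_EL (g * (EL z' * g⁻¹)) z (by rw [n2']; exact a1 _ rfl)
  refine ⟨cr_of_nc _ ?_, ?_⟩
  · rw [n3.2]
    have e : (EL z * (g * (EL z' * g⁻¹)))⁻¹ = g * (EL (linv z') * (g⁻¹ * EL (linv z))) := by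
      rw [← EL_inv, ← EL_inv]; group
    rw [e]
    have m1 : hd (g⁻¹ * EL (linv z)) = hd g⁻¹ := by
      apply hd_mul_nc _ _ (by simpa using hg)
      intro c hc hh
      rw [inv_inv] at hc
      rw [hd_EL] at hh
      exact a1 (linv z) rfl (hc.trans hh.symm)
    have m2 := (norm_mul_EL (g⁻¹ * EL (linv z)) (linv z') (by rw [m1]; exact a2 _ rfl)).2
    rw [hd_mul_nc _ _ hg]
    · exact a1 _ rfl
    · intro c hc hh
      rw [m2] at hh
      exact a2 (linv z') rfl (hc.trans hh.symm)
  · rw [n3.1, n2, n1.1, norm_inv_eq]; ring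

theorem lemF {k : ℕ} (z z' : Letter k) : ∀ (n : ℕ) (g : FG k), FreeGroup.norm g = n →
    ∀ v t, _root_.IsCyclicallyReduced v → FreeGroup.norm v ≤ 2 →
    EL z * (g * (EL z' * g⁻¹)) = t * v * t⁻¹ → ∃ p q : ℤ, g = EL z ^ p * EL z' ^ q := by
  intro n
  induction n using Nat.strong_induction_on with
  | _ n ih =>
    intro g hg v t hv hv2 he
    by_cases h0 : g = 1
    · exact ⟨0, 0, by simp [h0]⟩
    by_cases h1 : ∃ d, hd g = some d ∧ d.1 = z.1
    · obtain ⟨d, hd1, hd2⟩ := h1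
      have l1 := norm_mul_c g d hd1
      obtain ⟨p, q, hpq⟩ := ih (FreeGroup.norm (EL (linv d) * g)) (by omega) _ rfl v
        (EL (linv d) * t) hv hv2 (by
          have hc := comm_idx d z hd2
          have e1 : (EL d)⁻¹ * EL z = EL z * (EL d)⁻¹ := hc.inv_left.eq
          rw [← EL_inv]
          calc EL z * ((EL d)⁻¹ * g * (EL z' * ((EL d)⁻¹ * g)⁻¹))
              = (EL z * (EL d)⁻¹) * (g * (EL z' * g⁻¹)) * EL d := by group
            _ = (EL d)⁻¹ * (EL z * (g * (EL z' * g⁻¹))) * EL d := by rw [← e1]; group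
            _ = _ := by rw [he]; group)
      obtain ⟨e, he⟩ := EL_idx d z hd2
      refine ⟨e + p, q, ?_⟩
      rw [← EL_inv, inv_mul_eq_iff_eq_mul] at hpq
      rw [hpq, he, zpow_add, mul_assoc]
    by_cases h2 : ∃ d, hd g⁻¹ = some d ∧ d.1 = z'.1
    · obtain ⟨d, hd1, hd2⟩ := h2
      have l1 := norm_mul_right_c g d hd1
      obtain ⟨p, q, hpq⟩ := ih (FreeGroup.norm (g * EL d)) (by omega) _ rfl v t hv hv2 (by
          have hc := (comm_idx d z' hd2).eq
          rw [← he]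
          calc EL z * (g * EL d * (EL z' * (g * EL d)⁻¹))
              = EL z * (g * ((EL d * EL z') * ((EL d)⁻¹ * g⁻¹))) := by group
            _ = _ := by rw [hc]; group)
      obtain ⟨e, he⟩ := EL_idx d z' hd2
      refine ⟨p, q - e, ?_⟩
      rw [← eq_mul_inv_iff_mul_eq] at hpq
      rw [hpq, he, zpow_sub, mul_assoc]
    · push Not at h1 h2
      have h3 := big_cr z z' g h0 h1 h2
      have h4 := cr_len_le _ v t h3.1 hv he
      exfalso
      apply h0
      rw [← FreeGroup.norm_eq_zero]
      omega

theorem cr_EL {k : ℕ} (x : Letter k) : _root_.IsCyclicallyReduced (EL x) := by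
  apply cr_of_nc
  rw [EL_inv, hd_EL, hd_EL]
  simpa using linv_ne x

theorem cr_pair {k : ℕ} (i j : Fin k) (h : i ≠ j) :
    _root_.IsCyclicallyReduced (FreeGroup.of i * FreeGroup.of j) ∧
    FreeGroup.norm (FreeGroup.of i * FreeGroup.of j) ≤ 2 := by
  rw [of_eq_EL, of_eq_EL]
  constructor
  · apply cr_of_nc
    rw [mul_inv_rev, EL_inv, EL_inv, (norm_mul_EL _ _ _).2, (norm_mul_EL _ _ _).2]
    · simp [linv]
    · rw [hd_EL]; simp [linv]
    · rw [hd_EL]; simp [linv, h]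
  · exact (FreeGroup.norm_mul_le _ _).trans (by rw [norm_EL, norm_EL])

/-- short automorphisms -/
def Short {k : ℕ} (α : MulAut (FG k)) : Prop :=
  ∀ u, _root_.IsCyclicallyReduced u → ∃ v z, _root_.IsCyclicallyReduced v ∧ α u = z * v * z⁻¹ ∧
    FreeGroup.norm v ≤ FreeGroup.norm u

theorem short_gen {k : ℕ} (α : MulAut (FG k)) (hα : Short α) (i : Fin k) :
    ∃ g z, α (FreeGroup.of i) = g * EL z * g⁻¹ := by
  obtain ⟨v, g, h1, h2, h3⟩ := hα _ (cr_EL (i, true))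
  rw [norm_EL] at h3
  have h4 : v ≠ 1 := by
    rintro rfl
    have : α (EL (i, true)) = 1 := by rw [h2]; group
    rw [map_eq_one_iff _ α.injective] at this
    have h5 := norm_EL (i, true)
    rw [this] at h5; simp at h5
  obtain ⟨z, hz⟩ : ∃ z, toWord v = [z] := by
    rw [← List.length_eq_one_iff]
    have : FreeGroup.norm v ≠ 0 := by simpa using h4
    simp only [FreeGroup.norm] at this h3
    omega
  refine ⟨g, z, ?_⟩
  rw [of_eq_EL, h2, EL, ← hz, mk_toWord]

theorem short_pair {k : ℕ} (α : MulAut (FG k)) (hα : Short α) (i j : Fin k) (hij : i ≠ j)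
    (a b : FG k) (x y : Letter k) (h1 : α (FreeGroup.of i) = a * EL x * a⁻¹)
    (h2 : α (FreeGroup.of j) = b * EL y * b⁻¹) :
    ∃ p q : ℤ, a⁻¹ * b = EL x ^ p * EL y ^ q := by
  obtain ⟨c1, c2⟩ := cr_pair i j hij
  obtain ⟨v, t, hv, h3, h4⟩ := hα _ c1
  apply lemF x y _ (a⁻¹ * b) rfl v (a⁻¹ * t) hv (h4.trans c2)
  rw [_root_.map_mul, h1, h2] at h3
  calc _ = a⁻¹ * (a * EL x * a⁻¹ * (b * EL y * b⁻¹)) * a := by group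
    _ = _ := by rw [h3]; group

/-- killing hom -/
def killH {k : ℕ} (i : Fin k) : FG k →* FG k :=
  FreeGroup.lift (fun j => if j = i then 1 else FreeGroup.of j)

theorem killH_EL {k : ℕ} (i : Fin k) (x : Letter k) :
    killH i (EL x) = if x.1 = i then 1 else EL x := by
  obtain ⟨j, b⟩ := x
  by_cases h : j = i
  · cases b
    · rw [← of_inv_eq_EL, _root_.map_inv, killH, FreeGroup.lift_apply_of]; simp [h]
    · rw [← of_eq_EL, killH, FreeGroup.lift_apply_of]
  · cases b
    · rw [← of_inv_eq_EL, _root_.map_inv, killH, FreeGroup.lift_apply_of]; simp [h]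
    · rw [← of_eq_EL, killH, FreeGroup.lift_apply_of]

theorem conj_zpow_idx {k : ℕ} (x y : Letter k) (h : x.1 = y.1) (p : ℤ) :
    EL x ^ p * EL y * (EL x ^ p)⁻¹ = EL y := by
  rw [((comm_idx x y h).zpow_left p).eq, mul_inv_cancel_right]

theorem conj_simp {k : ℕ} (b c y : FG k) (q : ℤ) (h : b = c * y ^ q) :
    b * y * b⁻¹ = c * y * c⁻¹ := by
  rw [h, mul_inv_rev]
  have : y ^ q * y = y * y ^ q := (Commute.refl y).zpow_left q |>.eq
  calc _ = c * (y ^ q * y) * ((y ^ q)⁻¹ * c⁻¹) := by group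
    _ = _ := by rw [this]; group

theorem short_letters {k : ℕ} (β : MulAut (FG k)) (hβ : Short β) (i0 i1 : Fin k) (h01 : i0 ≠ i1)
    (z0 z1 : Letter k) (h0 : β (FreeGroup.of i0) = EL z0) (h1 : β (FreeGroup.of i1) = EL z1)
    (j : Fin k) : ∃ z, β (FreeGroup.of j) = EL z := by
  by_cases hj0 : j = i0
  · exact ⟨z0, by rw [hj0, h0]⟩
  by_cases hj1 : j = i1
  · exact ⟨z1, by rw [hj1, h1]⟩
  obtain ⟨g, z, hg⟩ := short_gen β hβ j
  obtain ⟨p, q, e1⟩ := short_pair β hβ i0 j (fun h => hj0 h.symm) 1 g z0 z (by simpa using h0) hg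
  obtain ⟨p', q', e2⟩ := short_pair β hβ i1 j (fun h => hj1 h.symm) 1 g z1 z (by simpa using h1) hg
  rw [inv_one, one_mul] at e1 e2
  have f1 := hg.trans (conj_simp _ _ _ _ e1)
  have f2 := hg.trans (conj_simp _ _ _ _ e2)
  refine ⟨z, ?_⟩
  by_cases k0 : z0.1 = z.1
  · rw [f1, conj_zpow_idx _ _ k0]
  by_cases k1 : z1.1 = z.1
  · rw [f2, conj_zpow_idx _ _ k1]
  have k01 : z0.1 ≠ z1.1 := by
    intro h
    have h3 := (comm_idx z0 z1 h).eq
    rw [← h0, ← h1, ← _root_.map_mul, ← _root_.map_mul] at h3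
    have h4 := congrArg hd (β.injective h3)
    rw [of_eq_EL, of_eq_EL, (norm_mul_EL _ _ _).2, (norm_mul_EL _ _ _).2] at h4
    · simp at h4; exact h01 h4
    · rw [hd_EL]; simp [linv]
    · rw [hd_EL]; simp [linv]
  have f3 := congrArg (killH z1.1) (f1.symm.trans f2)
  simp only [_root_.map_mul, _root_.map_inv, map_zpow, killH_EL, if_neg k01,
    if_neg (Ne.symm k1), if_true] at f3
  rw [f1, f3]; simp

theorem relabel {k : ℕ} (β : MulAut (FG k)) (h : ∀ j, ∃ z, β (FreeGroup.of j) = EL z) :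
    IsRelabeling β := by
  have hl : letterSet k = Set.range (EL : Letter k → FG k) := by
    ext x
    constructor
    · rintro ⟨i, h | h⟩
      · exact ⟨(i, true), h.symm⟩
      · exact ⟨(i, false), (h.trans (of_inv_eq_EL i)).symm⟩
    · rintro ⟨⟨i, b⟩, rfl⟩
      cases b
      · exact ⟨i, Or.inr (of_inv_eq_EL i).symm⟩
      · exact ⟨i, Or.inl rfl⟩
  have hfin : (letterSet k).Finite := by rw [hl]; exact Set.finite_range _
  apply Set.eq_of_subset_of_ncard_le _ _ hfin
  · rintro _ ⟨x, ⟨i, hx | hx⟩, rfl⟩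
    · obtain ⟨z, hz⟩ := h i
      rw [hl, hx, hz]; exact ⟨z, rfl⟩
    · obtain ⟨z, hz⟩ := h i
      rw [hl, hx, _root_.map_inv, hz, EL_inv]; exact ⟨_, rfl⟩
  · rw [Set.ncard_image_of_injective _ β.injective]

theorem main_core {k : ℕ} (hk : 2 ≤ k) (u : FG k) (hu : u ∈ TS k) (α : MulAut (FG k))
    (h : IsConj (α u) u) : IsInner α := by
  have hsh : ∀ γ : MulAut (FG k), IsConj (γ u) u → Short γ := by
    intro γ hγ
    obtain ⟨x, hx⟩ := isConj_iff.1 hγ.symm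
    intro s hs
    exact len_le u hu.1 γ x hx.symm s hs
  have hα := hsh α h
  let i0 : Fin k := ⟨0, by omega⟩
  let i1 : Fin k := ⟨1, by omega⟩
  have h01 : i0 ≠ i1 := by intro h; simp [i0, i1] at h
  obtain ⟨g0, z0, e0⟩ := short_gen α hα i0
  obtain ⟨g1, z1, e1⟩ := short_gen α hα i1
  obtain ⟨p, q, e2⟩ := short_pair α hα i0 i1 h01 _ _ _ _ e0 e1
  obtain ⟨c, hc⟩ : ∃ c, c = g0 * EL z0 ^ p := ⟨_, rfl⟩
  have f1 : α (FreeGroup.of i1) = c * EL z1 * c⁻¹ := by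
    rw [e1]
    apply conj_simp _ _ _ q
    rw [inv_mul_eq_iff_eq_mul] at e2
    rw [e2, hc, mul_assoc]
  have f0 : α (FreeGroup.of i0) = c * EL z0 * c⁻¹ := by
    rw [e0]
    exact (conj_simp _ _ _ p hc).symm
  have hβ : ∀ g, (MulAut.conj c⁻¹ * α) g = c⁻¹ * α g * c := by
    intro g; simp [MulAut.mul_apply]
  have hconj : IsConj ((MulAut.conj c⁻¹ * α) u) u := by
    rw [hβ]
    refine IsConj.trans (IsConj.symm ?_) h
    exact isConj_iff.2 ⟨c⁻¹, by simp⟩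
  have hl := short_letters (MulAut.conj c⁻¹ * α) (hsh _ hconj) i0 i1 h01 z0 z1
    (by rw [hβ, f0]; group) (by rw [hβ, f1]; group)
  have hr := relabel _ hl
  by_cases hone : MulAut.conj c⁻¹ * α = 1
  · refine ⟨c, ?_⟩
    rw [_root_.map_inv, inv_mul_eq_one] at hone
    exact hone.symm
  · exact absurd hconj (hu.2.2 _ hr hone)

end Proof

/-- for nontrivial `w ∈ TS'`, the stabilizer in `Out(F_k)` of the
conjugacy class of `w` is trivial: if `α w` is conjugate to `w` then `α` is inner
(its image in `Out(F_k)` is trivial). -/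
theorem TS'_out_stabilizer_trivial (k : ℕ) (hk : 2 ≤ k) (w : FG k)
    (hw : w ∈ TS' k) (hne : w ≠ 1) (α : MulAut (FG k)) (h : IsConj (α w) w) :
    IsInner α := by
  obtain ⟨x, u, hu, rfl⟩ := hw
  apply main_core hk u hu α
  have h1 : IsConj (α u) (α (x * u * x⁻¹)) :=
    isConj_iff.2 ⟨α x, by simp⟩
  have h2 : IsConj u (x * u * x⁻¹) := isConj_iff.2 ⟨x, rfl⟩
  exact (h1.trans h).trans h2.symm
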